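/- Let Q ≥ 100 be an integer. Then there is at most one primitive Dirichlet character χ of conductor at most Q for which L(s, χ) has a zero s = σ + it (σ, t real) with 1 − σ < 1/(24·log(Q(1+|t|))). Moreover, if such a character χ exists, then χ is a real (quadratic) character, and every zero s = σ + it of L(s, χ) with 1 − σ < 1/(24·log(Q(1+|t|))) satisfies t = 0 (i.e. it is a real zero). -/

import Mathlib

open Real

/-- A primitive Dirichlet character (of modulus `p.1 ≤ Q`, hence of conductor `≤ Q`) whose
`L`-function has a zero `s = σ + it` with `1 − σ < 1/(24·log(Q(1+|t|)))`. -/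
def HasExceptionalZero (Q : ℕ) (p : Σ n : ℕ, DirichletCharacter ℂ n) : Prop :=
  ∃ h : NeZero p.1, p.1 ≤ Q ∧ p.2.IsPrimitive ∧
    ∃ s : ℂ, @DirichletCharacter.LFunction p.1 h p.2 s = 0 ∧
      1 - s.re < 1 / (24 * Real.log ((Q : ℝ) * (1 + |s.im|)))

section EntireFunctions

open Metric Complex

theorem exists_eq_sub_mul_of_eq_zero {f : ℂ → ℂ} (hf : Differentiable ℂ f) {w : ℂ} (hw : f w = 0) :
    ∃ h : ℂ → ℂ, Differentiable ℂ h ∧ ∀ z, f z = (z - w) * h z := by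
  refine ⟨dslope f w, ?_, fun z => ?_⟩
  · rw [← differentiableOn_univ] at hf ⊢
    exact (differentiableOn_dslope Filter.univ_mem).2 hf
  · have := sub_smul_dslope f w z
    rw [smul_eq_mul, hw, sub_zero] at this
    exact this.symm

theorem norm_cofactor_le {f h : ℂ → ℂ} {c : ℂ} {R M : ℝ} (hR : 0 < R) {n : ℕ} {ρ : Fin n → ℂ}
    (hh : Differentiable ℂ h) (hρ : ∀ i, ρ i ∈ ball c R)
    (hfh : ∀ z, f z = (∏ i, (z - ρ i)) * h z) (hM : ∀ z ∈ sphere c (3 * R), ‖f z‖ ≤ M)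
    {z : ℂ} (hz : z ∈ closedBall c (3 * R)) : ‖h z‖ ≤ M / (2 * R) ^ n := by
  have hR3 : (3 * R) ≠ 0 := by positivity
  refine norm_le_of_forall_mem_frontier_norm_le (U := ball c (3 * R)) isBounded_ball
    hh.diffContOnCl (fun w hw => ?_) (by rwa [closure_ball c hR3])
  rw [frontier_ball c hR3] at hw
  have h1 := hM w hw
  rw [hfh, norm_mul, norm_prod] at h1
  rw [le_div_iff₀ (by positivity), mul_comm]
  refine le_trans (mul_le_mul_of_nonneg_right ?_ (norm_nonneg _)) h1
  calc (2 * R) ^ n = ∏ _i : Fin n, (2 * R) := by simp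
    _ ≤ _ := by
      refine Finset.prod_le_prod (fun _ _ => by positivity) fun i _ => ?_
      have h2 := hρ i
      rw [mem_ball, dist_eq_norm] at h2
      rw [mem_sphere, dist_eq_norm] at hw
      have h3 : w - c = (w - ρ i) + (ρ i - c) := by ring
      have h4 := norm_add_le (w - ρ i) (ρ i - c)
      rw [← h3] at h4
      linarith

theorem norm_le_pow_mul_norm_cofactor {f h : ℂ → ℂ} {c : ℂ} {R : ℝ} {n : ℕ} {ρ : Fin n → ℂ}
    (hρ : ∀ i, ρ i ∈ ball c R) (hfh : ∀ z, f z = (∏ i, (z - ρ i)) * h z) :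
    ‖f c‖ ≤ R ^ n * ‖h c‖ := by
  rw [hfh, norm_mul, norm_prod]
  refine mul_le_mul_of_nonneg_right ?_ (norm_nonneg _)
  calc ∏ i, ‖c - ρ i‖ ≤ ∏ _i : Fin n, R := by
        refine Finset.prod_le_prod (fun _ _ => norm_nonneg _) fun i _ => ?_
        have := hρ i
        rw [mem_ball, dist_comm, dist_eq_norm] at this
        exact this.le
    _ = R ^ n := by simp

/-- An entire function is the product of the linear factors of its zeros in a disc and an entire
function without zeros in that disc. -/
theorem exists_factorization_of_zeros_in_ball {f : ℂ → ℂ} (hf : Differentiable ℂ f) {c : ℂ}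
    (hc : f c ≠ 0) {R : ℝ} (hR : 0 < R) :
    ∃ (n : ℕ) (ρ : Fin n → ℂ) (h : ℂ → ℂ), Differentiable ℂ h ∧ (∀ i, ρ i ∈ ball c R) ∧
      (∀ z, f z = (∏ i, (z - ρ i)) * h z) ∧ ∀ z ∈ ball c R, h z ≠ 0 := by
  classical
  let P : ℕ → Prop := fun n => ∃ (ρ : Fin n → ℂ) (h : ℂ → ℂ), Differentiable ℂ h ∧
    (∀ i, ρ i ∈ ball c R) ∧ ∀ z, f z = (∏ i, (z - ρ i)) * h z
  have hP0 : P 0 := ⟨Fin.elim0, f, hf, fun i => i.elim0, fun z => by simp⟩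
  obtain ⟨M, hM⟩ := (isCompact_sphere c (3 * R)).exists_bound_of_continuousOn
    hf.continuous.continuousOn
  have hfc : 0 < ‖f c‖ := norm_pos_iff.2 hc
  obtain ⟨N, hN⟩ := pow_unbounded_of_one_lt (M / ‖f c‖) (one_lt_two)
  have hbound : ∀ n, P n → n ≤ N := by
    rintro n ⟨ρ, h, hh, hρ, hfh⟩
    by_contra! hn
    have h1 := norm_cofactor_le hR hh hρ hfh hM (z := c) (by simp; positivity)
    have h2 := norm_le_pow_mul_norm_cofactor hρ hfh
    have h3 : ‖f c‖ ≤ R ^ n * (M / (2 * R) ^ n) :=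
      h2.trans (mul_le_mul_of_nonneg_left h1 (by positivity))
    have h4 : R ^ n * (M / (2 * R) ^ n) = M / 2 ^ n := by
      rw [mul_pow]; field_simp
    rw [h4, le_div_iff₀ (by positivity)] at h3
    rw [div_lt_iff₀ hfc] at hN
    have h5 : (2 : ℝ) ^ N ≤ 2 ^ n := pow_le_pow_right₀ one_le_two hn.le
    nlinarith
  have hmax := Nat.findGreatest_spec (P := P) (Nat.zero_le N) hP0
  obtain ⟨ρ, h, hh, hρ, hfh⟩ := hmax
  refine ⟨_, ρ, h, hh, hρ, hfh, fun w hw hw0 => ?_⟩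
  obtain ⟨g, hg, hgh⟩ := exists_eq_sub_mul_of_eq_zero hh hw0
  have hP : P (Nat.findGreatest P N + 1) := by
    refine ⟨Fin.cons w ρ, g, hg, fun i => ?_, fun z => ?_⟩
    · refine Fin.cases ?_ (fun j => ?_) i
      · simpa using hw
      · simpa using hρ j
    · rw [Fin.prod_univ_succ, hfh, hgh]
      simp only [Fin.cons_zero, Fin.cons_succ]
      ring
  have := Nat.le_findGreatest (hbound _ hP) hP
  omega

/-- A zero-free function that is bounded by a multiple of its central value has an almost constant
logarithmic derivative near the centre. -/
theorem norm_logDeriv_sub_le {h : ℂ → ℂ} (hh : Differentiable ℂ h) {c : ℂ} {R K : ℝ} (hR : 0 < R)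
    (hK : 0 < K) (h0 : ∀ z ∈ ball c R, h z ≠ 0)
    (hb : ∀ z ∈ ball c R, ‖h z‖ ≤ Real.exp K * ‖h c‖) {w : ℂ} (hw : ‖w - c‖ ≤ R / 8) :
    ‖logDeriv h w - logDeriv h c‖ ≤ 64 * K / R ^ 2 * ‖w - c‖ := by
  have hcR : c ∈ ball c R := mem_ball_self hR
  have hdl : DifferentiableOn ℂ (logDeriv h) (ball c R) := by
    intro z hz
    refine DifferentiableAt.differentiableWithinAt ?_
    unfold logDeriv
    exact (hh.deriv z).div (hh z) (h0 z hz)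
  obtain ⟨g, hgc, hg⟩ := hdl.isExactOn_ball.with_val_at c 0
  have hconst : ∀ z ∈ ball c R, h z * exp (-g z) = h c := by
    intro z hz
    have hd : ∀ x ∈ ball c R, HasDerivAt (fun z => h z * exp (-g z)) 0 x := by
      intro x hx
      have h1 : HasDerivAt (fun z => h z * exp (-g z)) _ x :=
        (hh x).hasDerivAt.mul ((hg x hx).neg.cexp)
      refine h1.congr_deriv ?_
      rw [logDeriv_apply]
      field_simp [h0 x hx]
      simp
    have h2 := (convex_ball c R).norm_image_sub_le_of_norm_hasDerivWithin_le (𝕜 := ℂ) (C := 0)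
      (fun x hx => (hd x hx).hasDerivWithinAt) (by simp) hcR hz
    rw [zero_mul, norm_le_zero_iff, sub_eq_zero] at h2
    simpa [hgc] using h2
  have hre : ∀ z ∈ ball c R, (g z).re ≤ K := by
    intro z hz
    have h1 := hconst z hz
    have h2 : h z = h c * exp (g z) := by
      rw [← h1, mul_assoc, ← Complex.exp_add]; simp
    have h3 := hb z hz
    rw [h2, norm_mul, mul_comm, Complex.norm_exp] at h3
    have h4 := le_of_mul_le_mul_right h3 (norm_pos_iff.2 (h0 c hcR))
    exact Real.exp_le_exp.1 h4
  have hgd : DifferentiableOn ℂ g (ball c R) := fun z hz =>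
    (hg z hz).differentiableAt.differentiableWithinAt
  have hbc : ∀ z, ‖z - c‖ ≤ R / 2 → ‖g z‖ ≤ 2 * K := by
    intro z hz
    have hmem : ∀ u ∈ ball (0 : ℂ) R, u + c ∈ ball c R := by
      intro u hu; simpa using hu
    have h1 := borelCaratheodory_zero (f := fun u => g (u + c)) (M := K) (R := R) (z := z - c) hK
      (hgd.comp ((differentiable_id.add_const c).differentiableOn) hmem)
      (fun u hu => hre _ (hmem u hu)) hR (by rw [mem_ball_zero_iff]; linarith) (by simpa using hgc)
    simp only [sub_add_cancel] at h1
    refine h1.trans ?_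
    rw [div_le_iff₀ (by linarith)]
    nlinarith
  have hball : ∀ {r : ℝ} {x z : ℂ}, ‖x - c‖ + r < R → z ∈ closedBall x r → z ∈ ball c R := by
    intro r x z hx hz
    rw [mem_closedBall] at hz
    rw [mem_ball]
    have := dist_triangle z x c
    rw [dist_eq_norm x c] at this
    linarith
  have hd1 : ∀ z, ‖z - c‖ ≤ R / 4 → ‖logDeriv h z‖ ≤ 8 * K / R := by
    intro z hz
    have h1 : ‖deriv g z‖ ≤ (2 * K) / (R / 4) := by
      refine norm_deriv_le_of_forall_mem_sphere_norm_le (by positivity) ?_ fun u hu => hbc u ?_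
      · refine DifferentiableOn.diffContOnCl ?_
        rw [closure_ball _ (by positivity)]
        exact hgd.mono fun u hu => hball (by linarith) hu
      · rw [mem_sphere, dist_eq_norm] at hu
        have := norm_add_le (u - z) (z - c)
        rw [sub_add_sub_cancel] at this
        linarith
    have hzR : z ∈ ball c R := by rw [mem_ball, dist_eq_norm]; linarith
    rw [(hg z hzR).deriv] at h1
    convert h1 using 1
    field_simp
    norm_num
  have hd2 : ∀ z, ‖z - c‖ ≤ R / 8 → ‖deriv (logDeriv h) z‖ ≤ 64 * K / R ^ 2 := by
    intro z hz
    have h1 : ‖deriv (logDeriv h) z‖ ≤ (8 * K / R) / (R / 8) := by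
      refine norm_deriv_le_of_forall_mem_sphere_norm_le (by positivity) ?_ fun u hu => hd1 u ?_
      · refine DifferentiableOn.diffContOnCl ?_
        rw [closure_ball _ (by positivity)]
        exact hdl.mono fun u hu => hball (by linarith) hu
      · rw [mem_sphere, dist_eq_norm] at hu
        have := norm_add_le (u - z) (z - c)
        rw [sub_add_sub_cancel] at this
        linarith
    convert h1 using 1
    field_simp
    norm_num
  refine (convex_closedBall c (R / 8)).norm_image_sub_le_of_norm_deriv_le (𝕜 := ℂ) (fun x hx => ?_)
    (fun x hx => hd2 x ?_) (mem_closedBall_self (by positivity))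
    (by rwa [mem_closedBall, dist_eq_norm])
  · refine (hdl x ?_).differentiableAt (isOpen_ball.mem_nhds ?_) <;>
    · rw [mem_closedBall] at hx
      rw [mem_ball]
      linarith
  · rwa [mem_closedBall, dist_eq_norm] at hx

end EntireFunctions

section ZeroSums

open Metric Complex

/-- `f` grows more slowly than every Gaussian `exp (ε * ‖z‖ ^ 2)`. -/
def HasSubGaussianGrowth (f : ℂ → ℂ) : Prop :=
  ∀ ε : ℝ, 0 < ε → ∃ K : ℝ, ∀ z : ℂ, ‖f z‖ ≤ K * Real.exp (ε * ‖z‖ ^ 2)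

theorem logDeriv_prod_sub_mul {n : ℕ} {ρ : Fin n → ℂ} {f h : ℂ → ℂ} (hh : Differentiable ℂ h)
    (hfh : ∀ z, f z = (∏ i, (z - ρ i)) * h z) {z : ℂ} (hz : f z ≠ 0) :
    logDeriv f z = ∑ i, 1 / (z - ρ i) + logDeriv h z := by
  have hz' := hz
  rw [hfh] at hz'
  have h1 := left_ne_zero_of_mul hz'
  have h2 := right_ne_zero_of_mul hz'
  have hff : f = fun z => (∏ i, (z - ρ i)) * h z := funext hfh
  have hd : ∀ i ∈ Finset.univ, DifferentiableAt ℂ (fun z => z - ρ i) z := fun i _ => by fun_prop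
  rw [hff, logDeriv_mul z h1 h2 (by fun_prop) (hh z),
    logDeriv_prod (fun i hi => (Finset.prod_ne_zero_iff.1 h1) i hi) hd]
  congr 1
  refine Finset.sum_congr rfl fun i _ => ?_
  simp [logDeriv_apply]

/-- A difference of values of the logarithmic derivative dominates the corresponding sum over
finitely many zeros, as soon as each zero contributes a nonnegative amount. -/
theorem sum_zeros_le_re_logDeriv_sub {f : ℂ → ℂ} (hf : Differentiable ℂ f)
    (hgr : HasSubGaussianGrowth f) {s₀ s₁ : ℂ} (h₀ : f s₀ ≠ 0) (h₁ : f s₁ ≠ 0)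
    (hpos : ∀ ρ, f ρ = 0 → 0 ≤ (1 / (s₀ - ρ) - 1 / (s₁ - ρ)).re) {F : Finset ℂ}
    (hF : ∀ ρ ∈ F, f ρ = 0) :
    ∑ ρ ∈ F, (1 / (s₀ - ρ) - 1 / (s₁ - ρ)).re ≤ (logDeriv f s₀ - logDeriv f s₁).re := by
  refine le_of_forall_pos_le_add fun δ hδ => ?_
  set d := ‖s₁ - s₀‖ with hd
  have hd0 : 0 ≤ d := norm_nonneg _
  set ε := δ / (64 * 16 * 2 * (d + 1)) with hε
  have hε0 : 0 < ε := by positivity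
  obtain ⟨K, hK⟩ := hgr ε hε0
  have hf0 : 0 < ‖f s₀‖ := norm_pos_iff.2 h₀
  have hK0 : 0 < K := by
    have := hf0.trans_le (hK s₀)
    exact pos_of_mul_pos_left this (Real.exp_nonneg _)
  set c := |Real.log (K / ‖f s₀‖)| + 1 with hc
  have hc0 : 0 < c := by positivity
  obtain ⟨R, hR1, hRs, hRd, hRc, hRF⟩ : ∃ R : ℝ, 1 ≤ R ∧ ‖s₀‖ ≤ R ∧ 8 * d ≤ R ∧
      64 * c * d * 2 / δ ≤ R ∧ ∀ ρ ∈ F, ‖ρ - s₀‖ < R := by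
    have h1 : ∀ᶠ R : ℝ in Filter.atTop, ∀ ρ ∈ F, ‖ρ - s₀‖ < R :=
      (Filter.eventually_all_finset F).2 fun ρ _ => Filter.eventually_gt_atTop _
    exact ((Filter.eventually_ge_atTop 1).and ((Filter.eventually_ge_atTop _).and
      ((Filter.eventually_ge_atTop _).and ((Filter.eventually_ge_atTop _).and h1)))).exists
  have hR0 : 0 < R := by linarith
  obtain ⟨n, r, h, hh, hr, hfh, hne⟩ := exists_factorization_of_zeros_in_ball hf h₀ hR0
  set M := K * Real.exp (16 * ε * R ^ 2) with hMdef
  have hM : ∀ z ∈ sphere s₀ (3 * R), ‖f z‖ ≤ M := by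
    intro z hz
    rw [mem_sphere, dist_eq_norm] at hz
    have h1 : ‖z‖ ≤ 4 * R := by
      have := norm_add_le (z - s₀) s₀
      rw [sub_add_cancel] at this
      linarith
    refine (hK z).trans (mul_le_mul_of_nonneg_left (Real.exp_le_exp.2 ?_) hK0.le)
    have h2 : ‖z‖ ^ 2 ≤ (4 * R) ^ 2 := pow_le_pow_left₀ (norm_nonneg _) h1 2
    nlinarith
  have hM0 : 0 < M := by positivity
  have hb : ∀ z ∈ ball s₀ R, ‖h z‖ ≤ Real.exp (c + 16 * ε * R ^ 2) * ‖h s₀‖ := by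
    intro z hz
    have h1 := norm_cofactor_le hR0 hh hr hfh hM (z := z)
      (ball_subset_closedBall (ball_subset_ball (by linarith) hz))
    have h2 := norm_le_pow_mul_norm_cofactor hr hfh
    have hRn : 0 < R ^ n := by positivity
    have h3 : M / (2 * R) ^ n ≤ M / R ^ n :=
      div_le_div_of_nonneg_left hM0.le hRn (pow_le_pow_left₀ hR0.le (by linarith) n)
    have h4 : M / R ^ n ≤ M / ‖f s₀‖ * ‖h s₀‖ := by
      rw [div_mul_eq_mul_div, div_le_div_iff₀ hRn hf0, mul_assoc M, mul_comm ‖h s₀‖]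
      exact mul_le_mul_of_nonneg_left h2 hM0.le
    refine (h1.trans (h3.trans h4)).trans (mul_le_mul_of_nonneg_right ?_ (norm_nonneg _))
    rw [hMdef, Real.exp_add, mul_div_right_comm]
    refine mul_le_mul_of_nonneg_right ?_ (Real.exp_nonneg _)
    rw [← Real.log_le_iff_le_exp (by positivity), hc]
    linarith [le_abs_self (Real.log (K / ‖f s₀‖))]
  have hL := norm_logDeriv_sub_le hh hR0 (by positivity : 0 < c + 16 * ε * R ^ 2) hne hb
    (w := s₁) (by rw [← hd]; linarith)
  rw [← hd] at hL
  have hsmall : 64 * (c + 16 * ε * R ^ 2) / R ^ 2 * d ≤ δ := by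
    have e1 : 64 * (c + 16 * ε * R ^ 2) / R ^ 2 * d = 64 * c * d / R ^ 2 + 64 * 16 * ε * d := by
      field_simp
    rw [e1]
    have e2 : 64 * c * d / R ^ 2 ≤ δ / 2 := by
      rw [div_le_iff₀ hδ] at hRc
      rw [div_le_iff₀ (by positivity)]
      nlinarith [mul_le_mul_of_nonneg_left hR1 (by positivity : 0 ≤ R * δ)]
    have e3 : 64 * 16 * ε * d ≤ δ / 2 := by
      rw [hε]
      rw [show 64 * 16 * (δ / (64 * 16 * 2 * (d + 1))) * d = δ / 2 * (d / (d + 1)) by field_simp]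
      have : d / (d + 1) ≤ 1 := by rw [div_le_one (by positivity)]; linarith
      nlinarith
    linarith
  rw [logDeriv_prod_sub_mul hh hfh h₀, logDeriv_prod_sub_mul hh hfh h₁]
  have hre : -δ ≤ (logDeriv h s₀ - logDeriv h s₁).re := by
    have := (Complex.abs_re_le_norm (logDeriv h s₁ - logDeriv h s₀)).trans (hL.trans hsmall)
    have := (abs_le.1 this).2
    simp only [Complex.sub_re] at this ⊢
    linarith
  have hzero : ∀ i, f (r i) = 0 := fun i => by
    rw [hfh, Finset.prod_eq_zero (Finset.mem_univ i) (sub_self _), zero_mul]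
  have hsub : ∀ ρ ∈ F, ∃ i, r i = ρ := by
    intro ρ hρ
    have h1 := hF ρ hρ
    rw [hfh, mul_eq_zero] at h1
    have h2 := hne ρ (by rw [mem_ball, dist_eq_norm]; exact hRF ρ hρ)
    obtain ⟨i, -, hi⟩ := Finset.prod_eq_zero_iff.1 (h1.resolve_right h2)
    exact ⟨i, (sub_eq_zero.1 hi).symm⟩
  have hsum : ∑ ρ ∈ F, (1 / (s₀ - ρ) - 1 / (s₁ - ρ)).re ≤
      ∑ i, (1 / (s₀ - r i) - 1 / (s₁ - r i)).re := by
    classical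
    rcases F.eq_empty_or_nonempty with rfl | ⟨ρ₀, hρ₀⟩
    · rw [Finset.sum_empty]
      exact Finset.sum_nonneg fun i _ => hpos _ (hzero i)
    have : Nonempty (Fin n) := ⟨(hsub ρ₀ hρ₀).choose⟩
    choose! j hj using hsub
    have hinj : Set.InjOn j F := fun a ha b hb hab => by rw [← hj a ha, ← hj b hb, hab]
    calc ∑ ρ ∈ F, (1 / (s₀ - ρ) - 1 / (s₁ - ρ)).re
        = ∑ i ∈ F.image j, (1 / (s₀ - r i) - 1 / (s₁ - r i)).re := by
          rw [Finset.sum_image hinj]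
          exact Finset.sum_congr rfl fun ρ hρ => by rw [hj ρ hρ]
      _ ≤ _ := Finset.sum_le_sum_of_subset_of_nonneg (Finset.subset_univ _)
          fun i _ _ => hpos _ (hzero i)
  have hexp : (∑ i, 1 / (s₀ - r i) + logDeriv h s₀ - (∑ i, 1 / (s₁ - r i) + logDeriv h s₁)).re =
      ∑ i, (1 / (s₀ - r i) - 1 / (s₁ - r i)).re + (logDeriv h s₀ - logDeriv h s₁).re := by
    simp only [Complex.sub_re, Complex.add_re, Complex.re_sum, Finset.sum_sub_distrib]
    ring
  rw [hexp]
  linarith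

theorem one_div_sub_one_sub_conj (s ρ : ℂ) :
    1 / (1 - (starRingEnd ℂ) s - ρ) =
      -(starRingEnd ℂ) (1 / (s - (1 - (starRingEnd ℂ) ρ))) := by
  simp only [map_div₀, map_one, map_sub, Complex.conj_conj]
  rw [← div_neg]
  congr 1
  ring

theorem re_one_div_sub_nonneg {s ρ : ℂ} (h : ρ.re ≤ s.re) : 0 ≤ (1 / (s - ρ)).re := by
  rw [one_div, Complex.inv_re]
  exact div_nonneg (by simpa using h) (Complex.normSq_nonneg _)

theorem re_logDeriv_one_sub_conj {f : ℂ → ℂ} (hf : Differentiable ℂ f) {W : ℂ} (hW : W ≠ 0)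
    (hfe : ∀ s, f (1 - (starRingEnd ℂ) s) = W * (starRingEnd ℂ) (f s)) (s : ℂ) :
    (logDeriv f (1 - (starRingEnd ℂ) s)).re = -(logDeriv f s).re := by
  have h1 : HasDerivAt ((starRingEnd ℂ) ∘ f ∘ (starRingEnd ℂ)) ((starRingEnd ℂ) (deriv f s))
      ((starRingEnd ℂ) s) := (hf s).hasDerivAt.conj_conj
  have h2 : (fun z => f (1 - z)) = fun z => W * ((starRingEnd ℂ) ∘ f ∘ (starRingEnd ℂ)) z := by
    funext z
    have := hfe ((starRingEnd ℂ) z)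
    rw [Complex.conj_conj] at this
    exact this
  have h3 : HasDerivAt (fun z => f (1 - z)) (-deriv f (1 - (starRingEnd ℂ) s))
      ((starRingEnd ℂ) s) := by
    have := (hf (1 - (starRingEnd ℂ) s)).hasDerivAt.comp_const_sub 1 ((starRingEnd ℂ) s)
    exact this
  rw [h2] at h3
  have h4 := h3.unique (h1.const_mul W)
  rw [logDeriv_apply, hfe, neg_eq_iff_eq_neg.1 h4, logDeriv_apply, neg_div, Complex.neg_re,
    mul_div_mul_left _ _ hW, ← map_div₀, Complex.conj_re]

/-- Let `f` be an entire function of sub-Gaussian growth with a functional equation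
`f (1 - conj s) = W * conj (f s)` and all zeros in the critical strip. Then the real part of its
logarithmic derivative to the right of the strip dominates the contribution of any finite set of
zeros to the right of the critical line. -/
theorem sum_zeros_le_re_logDeriv {f : ℂ → ℂ} (hf : Differentiable ℂ f)
    (hgr : HasSubGaussianGrowth f) {W : ℂ} (hW : W ≠ 0)
    (hfe : ∀ s, f (1 - (starRingEnd ℂ) s) = W * (starRingEnd ℂ) (f s))
    (hright : ∀ s : ℂ, 1 < s.re → f s ≠ 0) {s : ℂ} (hs : 1 < s.re) {F : Finset ℂ}
    (hF : ∀ ρ ∈ F, f ρ = 0 ∧ 1 / 2 < ρ.re) :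
    ∑ ρ ∈ F, (1 / (s - ρ)).re ≤ (logDeriv f s).re := by
  classical
  have hsymm : ∀ {ρ}, f ρ = 0 → f (1 - (starRingEnd ℂ) ρ) = 0 := fun {ρ} h => by
    rw [hfe, h, map_zero, mul_zero]
  have hle : ∀ {ρ}, f ρ = 0 → ρ.re ≤ 1 := fun {ρ} h => by
    by_contra! h1
    exact hright ρ h1 h
  have hge : ∀ {ρ}, f ρ = 0 → 0 ≤ ρ.re := fun {ρ} h => by
    have := hle (hsymm h)
    simpa using this
  have hterm : ∀ ρ, (1 / (s - ρ) - 1 / (1 - (starRingEnd ℂ) s - ρ)).re =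
      (1 / (s - ρ)).re + (1 / (s - (1 - (starRingEnd ℂ) ρ))).re := fun ρ => by
    rw [one_div_sub_one_sub_conj, sub_neg_eq_add, Complex.add_re, Complex.conj_re]
  have hpos1 : ∀ ρ, f ρ = 0 → 0 ≤ (1 / (s - ρ)).re := fun ρ h =>
    re_one_div_sub_nonneg ((hle h).trans hs.le)
  have h1 : f (1 - (starRingEnd ℂ) s) ≠ 0 := by
    rw [hfe]
    exact mul_ne_zero hW ((map_ne_zero _).2 (hright s hs))
  have hinj : Set.InjOn (fun ρ : ℂ => 1 - (starRingEnd ℂ) ρ) F := fun a _ b _ hab =>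
    (starRingEnd ℂ).injective (sub_right_injective hab)
  have hdisj : Disjoint F (F.image fun ρ => 1 - (starRingEnd ℂ) ρ) := by
    rw [Finset.disjoint_left]
    intro ρ hρ hρ'
    obtain ⟨τ, hτ, rfl⟩ := Finset.mem_image.1 hρ'
    have h2 := (hF _ hρ).2
    have h3 := (hF _ hτ).2
    simp at h2
    linarith
  have key := sum_zeros_le_re_logDeriv_sub hf hgr (hright s hs) h1
    (fun ρ h => by rw [hterm]; exact add_nonneg (hpos1 _ h) (hpos1 _ (hsymm h)))
    (F := F ∪ F.image fun ρ => 1 - (starRingEnd ℂ) ρ) (fun ρ hρ => by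
      rcases Finset.mem_union.1 hρ with h | h
      · exact (hF ρ h).1
      · obtain ⟨τ, hτ, rfl⟩ := Finset.mem_image.1 h
        exact hsymm (hF τ hτ).1)
  rw [Finset.sum_union hdisj, Finset.sum_image hinj, Complex.sub_re,
    re_logDeriv_one_sub_conj hf hW hfe] at key
  have h4 : ∑ ρ ∈ F, (1 / (s - (1 - (starRingEnd ℂ) ρ)) -
        1 / (1 - (starRingEnd ℂ) s - (1 - (starRingEnd ℂ) ρ))).re =
      ∑ ρ ∈ F, (1 / (s - ρ) - 1 / (1 - (starRingEnd ℂ) s - ρ)).re := by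
    refine Finset.sum_congr rfl fun ρ _ => ?_
    rw [hterm, hterm, map_sub, map_one, Complex.conj_conj, sub_sub_cancel, add_comm]
  have h5 : ∑ ρ ∈ F, (1 / (s - ρ)).re ≤
      ∑ ρ ∈ F, (1 / (s - ρ) - 1 / (1 - (starRingEnd ℂ) s - ρ)).re := by
    refine Finset.sum_le_sum fun ρ hρ => ?_
    rw [hterm]
    linarith [hpos1 _ (hsymm (hF ρ hρ).1)]
  rw [h4] at key
  linarith

end ZeroSums

section GammaBounds

open Complex Filter Topology Finset

theorem norm_mul_rpow_le_norm_add_mul_rpow {z : ℂ} (hz : 0 < z.re) (hy : |z.im| ≤ z.re) {h : ℝ}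
    (h0 : 0 ≤ h) (h1 : h ≤ 1) :
    ‖z‖ * (z.re + |z.im| + 1) ^ h ≤ ‖z + h‖ * (z.re + |z.im|) ^ h := by
  set X := z.re with hX
  set Y := |z.im| with hY
  have hY0 : 0 ≤ Y := abs_nonneg _
  set k := X + Y with hk
  have hk0 : 0 < k := by positivity
  have e1 : (k + 1) ^ h ≤ k ^ h * (1 + h / k) := by
    have : k + 1 = k * (1 + 1 / k) := by field_simp
    rw [this, Real.mul_rpow hk0.le (by positivity)]
    refine mul_le_mul_of_nonneg_left ?_ (by positivity)
    have := rpow_one_add_le_one_add_mul_self (s := 1 / k)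
      (by have : 0 ≤ 1 / k := by positivity
          linarith) h0 h1
    rwa [mul_one_div] at this
  have e2 : ‖z‖ * (1 + h / k) ≤ ‖z + h‖ := by
    refine le_of_sq_le_sq ?_ (norm_nonneg _)
    rw [mul_pow, Complex.sq_norm, Complex.sq_norm, Complex.normSq_apply, Complex.normSq_apply]
    simp only [Complex.add_re, Complex.ofReal_re, Complex.add_im, Complex.ofReal_im, add_zero]
    rw [← hX]
    have hyy : z.im * z.im = Y * Y := by rw [hY, abs_mul_abs_self]
    rw [hyy]
    have e3 : (X * X + Y * Y) / k ≤ X := by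
      rw [div_le_iff₀ hk0, hk]
      nlinarith
    have e4 : (X * X + Y * Y) / k ^ 2 ≤ 1 := by
      rw [div_le_one (by positivity), hk]
      nlinarith
    have e5 : (X * X + Y * Y) * (1 + h / k) ^ 2 =
        X * X + Y * Y + 2 * h * ((X * X + Y * Y) / k) + h ^ 2 * ((X * X + Y * Y) / k ^ 2) := by
      field_simp
      ring
    rw [e5]
    nlinarith [mul_le_mul_of_nonneg_left e3 h0, mul_le_mul_of_nonneg_left e4 (sq_nonneg h)]
  calc ‖z‖ * (k + 1) ^ h ≤ ‖z‖ * (k ^ h * (1 + h / k)) :=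
        mul_le_mul_of_nonneg_left e1 (norm_nonneg _)
    _ = ‖z‖ * (1 + h / k) * k ^ h := by ring
    _ ≤ _ := mul_le_mul_of_nonneg_right e2 (by positivity)

theorem norm_le_norm_add_ofReal {z : ℂ} (hz : 0 ≤ z.re) {h : ℝ} (h0 : 0 ≤ h) : ‖z‖ ≤ ‖z + h‖ := by
  refine le_of_sq_le_sq ?_ (norm_nonneg _)
  rw [Complex.sq_norm, Complex.sq_norm, Complex.normSq_apply, Complex.normSq_apply]
  simp only [Complex.add_re, Complex.ofReal_re, Complex.add_im, Complex.ofReal_im, add_zero]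
  nlinarith [mul_nonneg hz h0]

theorem norm_prod_mul_rpow_le {z : ℂ} (hz : 0 < z.re) {m : ℕ} (hm : |z.im| ≤ z.re + m) {h : ℝ}
    (h0 : 0 ≤ h) (h1 : h ≤ 1) {N : ℕ} (hN : m ≤ N) :
    ‖∏ j ∈ range N, (z + j)‖ * (N + (z.re + |z.im|)) ^ h ≤
      (m + (z.re + |z.im|)) ^ h * ‖∏ j ∈ range N, (z + h + j)‖ := by
  induction N, hN using Nat.le_induction with
  | base =>
    rw [mul_comm]
    refine mul_le_mul_of_nonneg_left ?_ (by positivity)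
    rw [norm_prod, norm_prod]
    refine prod_le_prod (fun _ _ => norm_nonneg _) fun j _ => ?_
    have := norm_le_norm_add_ofReal (z := z + j) (by simp; positivity) h0
    rwa [add_right_comm] at this
  | succ N hN ih =>
    rw [prod_range_succ, prod_range_succ, norm_mul, norm_mul]
    have hmN : (m : ℝ) ≤ N := by exact_mod_cast hN
    have h2 := norm_mul_rpow_le_norm_add_mul_rpow (z := z + N) (by simp; positivity)
      (by simp; linarith) h0 h1
    simp only [Complex.add_re, Complex.natCast_re, Complex.add_im, Complex.natCast_im,
      add_zero] at h2
    rw [show z.re + (N : ℝ) + |z.im| = N + (z.re + |z.im|) by ring,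
      add_right_comm z _ (h : ℂ)] at h2
    have hp : (0 : ℝ) < (N + (z.re + |z.im|)) ^ h := by positivity
    push_cast
    rw [add_right_comm]
    refine le_of_mul_le_mul_right ?_ hp
    calc _ = (‖∏ j ∈ range N, (z + j)‖ * (N + (z.re + |z.im|)) ^ h) *
          (‖z + N‖ * (N + (z.re + |z.im|) + 1) ^ h) := by ring
      _ ≤ ((m + (z.re + |z.im|)) ^ h * ‖∏ j ∈ range N, (z + h + j)‖) *
          (‖z + h + N‖ * (N + (z.re + |z.im|)) ^ h) :=
        mul_le_mul ih h2 (by positivity) (by positivity)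
      _ = _ := by ring

theorem norm_Gamma_add_le {z : ℂ} (hz : 0 < z.re) {m : ℕ} (hm : |z.im| ≤ z.re + m) {h : ℝ}
    (h0 : 0 ≤ h) (h1 : h ≤ 1) :
    ‖Complex.Gamma (z + h)‖ ≤ ‖Complex.Gamma z‖ * (m + (z.re + |z.im|)) ^ h := by
  refine le_of_tendsto_of_tendsto (GammaSeq_tendsto_Gamma (z + h)).norm
    ((GammaSeq_tendsto_Gamma z).norm.mul_const _) ?_
  filter_upwards [eventually_ge_atTop (m + 1)] with n hn
  have hn0 : 0 < n := by omega
  have key := norm_prod_mul_rpow_le hz hm h0 h1 (N := n + 1) (by omega)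
  have hp : ∀ w : ℂ, 0 < w.re → 0 < ‖∏ j ∈ range (n + 1), (w + j)‖ := fun w hw => by
    rw [norm_pos_iff, prod_ne_zero_iff]
    intro j _ hj
    have := congrArg Complex.re hj
    simp at this
    have h3 : (0 : ℝ) ≤ j := j.cast_nonneg
    linarith
  have hp1 := hp z hz
  have hp2 := hp (z + h) (by simp; positivity)
  unfold Complex.GammaSeq
  rw [norm_div, norm_div, norm_mul, norm_mul, Complex.norm_natCast_cpow_of_pos hn0,
    Complex.norm_natCast_cpow_of_pos hn0, div_mul_eq_mul_div, div_le_div_iff₀ hp2 hp1,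
    Complex.add_re, Complex.ofReal_re, Real.rpow_add (by positivity)]
  have h4 : (n : ℝ) ^ h ≤ ((n + 1 : ℕ) + (z.re + |z.im|)) ^ h := by
    refine Real.rpow_le_rpow (by positivity) ?_ h0
    push_cast
    have := abs_nonneg z.im
    linarith
  have h5 : ‖∏ j ∈ range (n + 1), (z + j)‖ * (n : ℝ) ^ h ≤
      (m + (z.re + |z.im|)) ^ h * ‖∏ j ∈ range (n + 1), (z + h + j)‖ :=
    (mul_le_mul_of_nonneg_left h4 hp1.le).trans key
  calc _ = (n : ℝ) ^ z.re * ‖(n.factorial : ℂ)‖ *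
        (‖∏ j ∈ range (n + 1), (z + j)‖ * (n : ℝ) ^ h) := by ring
    _ ≤ (n : ℝ) ^ z.re * ‖(n.factorial : ℂ)‖ * _ := mul_le_mul_of_nonneg_left h5 (by positivity)
    _ = _ := by ring

theorem re_logDeriv_Gamma_le_log_add {z : ℂ} (hz : 0 < z.re) {m : ℕ} (hm : |z.im| ≤ z.re + m) :
    (logDeriv Complex.Gamma z).re ≤ Real.log (m + (z.re + |z.im|)) := by
  set A : ℝ := m + (z.re + |z.im|) with hA
  have hA0 : 0 < A := by positivity
  have hG : Complex.Gamma z ≠ 0 := Complex.Gamma_ne_zero_of_re_pos hz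
  let φ : ℝ → ℝ := fun h => (Complex.Gamma (z + h) * cexp (-(h * Real.log A)) / Complex.Gamma z).re
  have hφ : HasDerivAt φ ((logDeriv Complex.Gamma z).re - Real.log A) 0 := by
    have h1 : HasDerivAt (fun h : ℂ => Complex.Gamma (z + h)) (deriv Complex.Gamma z) 0 := by
      have hd : DifferentiableAt ℂ Complex.Gamma (z + 0) := by
        rw [add_zero]
        refine Complex.differentiableAt_Gamma z fun n hn => ?_
        rw [hn] at hz
        simp at hz
        have h3 : (0 : ℝ) ≤ n := n.cast_nonneg
        linarith
      have := hd.hasDerivAt.comp_const_add z 0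
      rwa [add_zero] at this
    have h2 : HasDerivAt (fun h : ℂ => cexp (-(h * Real.log A))) (-(Real.log A : ℂ)) 0 := by
      have := (((hasDerivAt_id (0 : ℂ)).mul_const (Real.log A : ℂ)).neg).cexp
      simpa using this
    have h3 := ((h1.mul h2).div_const (Complex.Gamma z)).real_of_complex (z := 0)
    refine h3.congr_deriv ?_
    simp only [add_zero, zero_mul, neg_zero, Complex.exp_zero, mul_one, logDeriv_apply]
    rw [← Complex.ofReal_re (Real.log A), ← Complex.sub_re]
    congr 1
    field_simp
    simp [sub_eq_add_neg]
  have hle : ∀ h ∈ Set.Ioo (0 : ℝ) 1, φ h ≤ φ 0 := by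
    intro h hh
    have h0 : φ 0 = 1 := by simp [φ, hG]
    rw [h0]
    refine (Complex.re_le_norm _).trans ?_
    rw [norm_div, norm_mul, Complex.norm_exp, div_le_one (norm_pos_iff.2 hG)]
    have h1 := norm_Gamma_add_le hz hm hh.1.le hh.2.le
    rw [← hA, Real.rpow_def_of_pos hA0] at h1
    have h2 : (-((h : ℂ) * Real.log A)).re = -(Real.log A * h) := by
      rw [← Complex.ofReal_mul, ← Complex.ofReal_neg, Complex.ofReal_re, mul_comm]
    rw [h2]
    calc _ ≤ ‖Complex.Gamma z‖ * Real.exp (Real.log A * h) * Real.exp (-(Real.log A * h)) :=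
          mul_le_mul_of_nonneg_right h1 (Real.exp_nonneg _)
      _ = _ := by rw [mul_assoc, ← Real.exp_add]; simp
  have hlim : Tendsto (slope φ 0) (𝓝[>] 0) (𝓝 ((logDeriv Complex.Gamma z).re - Real.log A)) :=
    (hasDerivWithinAt_iff_tendsto_slope' (by simp)).1 hφ.hasDerivWithinAt
  have := le_of_tendsto hlim (b := 0) (by
    filter_upwards [Ioo_mem_nhdsGT (zero_lt_one' ℝ)] with h hh
    rw [slope_def_field]
    exact div_nonpos_of_nonpos_of_nonneg (by linarith [hle h hh]) (by linarith [hh.1]))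
  linarith

/-- An explicit upper bound for the real part of the digamma function on the right half plane. -/
theorem re_logDeriv_Gamma_le {z : ℂ} (hz : 0 < z.re) :
    (logDeriv Complex.Gamma z).re ≤ Real.log (1 + z.re + 2 * |z.im|) := by
  have hy := abs_nonneg z.im
  have hm : |z.im| ≤ z.re + ⌈|z.im| - z.re⌉₊ := by
    linarith [Nat.le_ceil (|z.im| - z.re)]
  refine (re_logDeriv_Gamma_le_log_add hz hm).trans (Real.log_le_log (by positivity) ?_)
  rcases le_or_gt |z.im| z.re with h | h
  · rw [Nat.ceil_eq_zero.2 (by linarith)]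
    push_cast
    linarith
  · linarith [Nat.ceil_lt_add_one (a := |z.im| - z.re) (by linarith)]

end GammaBounds

section SubGaussianGrowth

open Complex

namespace HasSubGaussianGrowth

variable {f g : ℂ → ℂ}

theorem exists_nonneg (hf : HasSubGaussianGrowth f) {ε : ℝ} (hε : 0 < ε) :
    ∃ K : ℝ, 0 ≤ K ∧ ∀ z : ℂ, ‖f z‖ ≤ K * Real.exp (ε * ‖z‖ ^ 2) := by
  obtain ⟨K, hK⟩ := hf ε hε
  refine ⟨K, ?_, hK⟩
  have := (norm_nonneg _).trans (hK 0)
  simpa using this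

theorem mul (hf : HasSubGaussianGrowth f) (hg : HasSubGaussianGrowth g) :
    HasSubGaussianGrowth fun z => f z * g z := by
  intro ε hε
  obtain ⟨K, hK0, hK⟩ := hf.exists_nonneg (half_pos hε)
  obtain ⟨L, hL0, hL⟩ := hg.exists_nonneg (half_pos hε)
  refine ⟨K * L, fun z => ?_⟩
  rw [norm_mul]
  refine (mul_le_mul (hK z) (hL z) (norm_nonneg _) (by positivity)).trans_eq ?_
  rw [mul_mul_mul_comm, ← Real.exp_add]
  congr 2
  ring

theorem add (hf : HasSubGaussianGrowth f) (hg : HasSubGaussianGrowth g) :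
    HasSubGaussianGrowth fun z => f z + g z := by
  intro ε hε
  obtain ⟨K, hK⟩ := hf ε hε
  obtain ⟨L, hL⟩ := hg ε hε
  refine ⟨K + L, fun z => ?_⟩
  rw [add_mul]
  exact (norm_add_le _ _).trans (add_le_add (hK z) (hL z))

theorem const (c : ℂ) : HasSubGaussianGrowth fun _ => c := by
  intro ε hε
  refine ⟨‖c‖, fun z => ?_⟩
  exact le_mul_of_one_le_right (norm_nonneg _) (Real.one_le_exp (by positivity))

theorem sum {ι : Type*} {s : Finset ι} {F : ι → ℂ → ℂ}
    (hF : ∀ i ∈ s, HasSubGaussianGrowth (F i)) : HasSubGaussianGrowth fun z => ∑ i ∈ s, F i z := by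
  classical
  induction s using Finset.induction_on with
  | empty => simpa using const 0
  | insert i s hi ih =>
    simp only [Finset.sum_insert hi]
    exact (hF i (Finset.mem_insert_self _ _)).add
      (ih fun j hj => hF j (Finset.mem_insert_of_mem hj))

theorem comp_affine (hf : HasSubGaussianGrowth f) (a b : ℂ) :
    HasSubGaussianGrowth fun z => f (a * z + b) := by
  intro ε hε
  set δ := ε / (2 * (‖a‖ ^ 2 + 1)) with hδ
  have hδ0 : 0 < δ := by positivity
  obtain ⟨K, hK0, hK⟩ := hf.exists_nonneg hδ0
  refine ⟨K * Real.exp (2 * δ * ‖b‖ ^ 2), fun z => (hK _).trans ?_⟩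
  rw [mul_assoc, ← Real.exp_add]
  refine mul_le_mul_of_nonneg_left (Real.exp_le_exp.2 ?_) hK0
  have h1 : ‖a * z + b‖ ≤ ‖a‖ * ‖z‖ + ‖b‖ := by
    rw [← norm_mul]
    exact norm_add_le _ _
  have h2 : ‖a * z + b‖ ^ 2 ≤ 2 * (‖a‖ ^ 2 * ‖z‖ ^ 2) + 2 * ‖b‖ ^ 2 := by
    have := pow_le_pow_left₀ (norm_nonneg _) h1 2
    nlinarith [sq_nonneg (‖a‖ * ‖z‖ - ‖b‖)]
  have h3 : 2 * δ * (‖a‖ ^ 2 + 1) = ε := by rw [hδ]; field_simp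
  have h4 : 2 * δ * ‖a‖ ^ 2 ≤ ε := by nlinarith
  nlinarith [mul_le_mul_of_nonneg_left h2 hδ0.le, mul_le_mul_of_nonneg_right h4 (sq_nonneg ‖z‖)]

theorem exp_const_mul (a : ℂ) : HasSubGaussianGrowth fun z => cexp (a * z) := by
  intro ε hε
  refine ⟨Real.exp (‖a‖ ^ 2 / ε), fun z => ?_⟩
  rw [Complex.norm_exp, ← Real.exp_add]
  refine Real.exp_le_exp.2 ((Complex.re_le_norm _).trans ?_)
  rw [norm_mul]
  have h1 : ‖a‖ ^ 2 / ε + ε * ‖z‖ ^ 2 - ‖a‖ * ‖z‖ =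
      ((‖a‖ - ε * ‖z‖ / 2) ^ 2 + 3 / 4 * (ε * ‖z‖) ^ 2) / ε := by
    field_simp
    ring
  have h2 : 0 ≤ ((‖a‖ - ε * ‖z‖ / 2) ^ 2 + 3 / 4 * (ε * ‖z‖) ^ 2) / ε := by positivity
  linarith

theorem natCast_cpow {N : ℕ} (hN : N ≠ 0) (a : ℂ) :
    HasSubGaussianGrowth fun z => (N : ℂ) ^ (a * z) := by
  have := exp_const_mul (Complex.log N * a)
  refine fun ε hε => ?_
  obtain ⟨K, hK⟩ := this ε hε
  refine ⟨K, fun z => ?_⟩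
  have h1 := hK z
  beta_reduce at h1 ⊢
  rwa [cpow_def_of_ne_zero (Nat.cast_ne_zero.2 hN), ← mul_assoc]

theorem id : HasSubGaussianGrowth fun z => z := by
  intro ε hε
  refine ⟨1 / ε + 1, fun z => ?_⟩
  have h1 : 1 + ε * ‖z‖ ^ 2 ≤ Real.exp (ε * ‖z‖ ^ 2) := by
    have := Real.add_one_le_exp (ε * ‖z‖ ^ 2)
    linarith
  refine le_trans ?_ (mul_le_mul_of_nonneg_left h1 (by positivity))
  have h2 : (1 / ε + 1) * (1 + ε * ‖z‖ ^ 2) = 1 / ε + ‖z‖ ^ 2 + 1 + ε * ‖z‖ ^ 2 := by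
    field_simp
    ring
  rw [h2]
  have : 0 < 1 / ε := by positivity
  nlinarith [sq_nonneg (‖z‖ - 1), mul_nonneg hε.le (sq_nonneg ‖z‖)]

end HasSubGaussianGrowth

open MeasureTheory Filter Asymptotics Set in
/-- The Mellin transform of an exponentially decaying function is sub-Gaussian on a right half
plane. -/
theorem norm_mellin_le_of_isBigO_exp {g : ℝ → ℂ} (hg : MellinConvergent g 0) {p : ℝ} (hp : 0 < p)
    (hO : g =O[atTop] fun x => Real.exp (-p * x)) {ε : ℝ} (hε : 0 < ε) :
    ∃ K : ℝ, ∀ s : ℂ, 0 ≤ s.re → ‖mellin g s‖ ≤ K * Real.exp (ε * ‖s‖ ^ 2) := by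
  let w : ℝ → ℝ := fun x => Real.exp (Real.log (max x 1) ^ 2 / (4 * ε))
  have hw0 : ∀ x, 0 ≤ w x := fun x => Real.exp_nonneg _
  have hwm : Measurable w := by fun_prop
  have hnorm : ∀ (s : ℂ) (x : ℝ), 0 < x →
      ‖(x : ℂ) ^ (s - 1) • g x‖ = x ^ (s.re - 1) * ‖g x‖ := fun s x hx => by
    rw [norm_smul, Complex.norm_cpow_eq_rpow_re_of_pos hx, Complex.sub_re, Complex.one_re]
  have hg' : IntegrableOn (fun x : ℝ => ‖(x : ℂ) ^ ((0 : ℂ) - 1) • g x‖) (Ioi 0) := hg.norm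
  let G : ℝ → ℝ := fun x => w x * ‖(x : ℂ) ^ ((0 : ℂ) - 1) • g x‖
  have hpow : ∀ s : ℂ, 0 ≤ s.re → ∀ x ∈ Ioi (0 : ℝ),
      ‖(x : ℂ) ^ (s - 1) • g x‖ ≤ Real.exp (ε * ‖s‖ ^ 2) * G x := by
    intro s hs x hx
    rw [mem_Ioi] at hx
    simp only [G]
    rw [hnorm s x hx, hnorm 0 x hx, Complex.zero_re, zero_sub, Real.rpow_sub_one hx.ne',
      Real.rpow_neg_one, div_eq_mul_inv, ← mul_assoc, mul_assoc (x ^ s.re), mul_assoc]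
    rw [show Real.exp (ε * ‖s‖ ^ 2) * (w x * (x⁻¹ * ‖g x‖)) =
      (Real.exp (ε * ‖s‖ ^ 2) * w x) * (x⁻¹ * ‖g x‖) by ring]
    refine mul_le_mul_of_nonneg_right ?_ (by positivity)
    simp only [w]
    rw [← Real.exp_add, Real.rpow_def_of_pos hx]
    refine Real.exp_le_exp.2 ?_
    set l := Real.log (max x 1)
    have h1 : Real.log x ≤ l := Real.log_le_log hx (le_max_left _ _)
    have h2 : s.re ^ 2 ≤ ‖s‖ ^ 2 := by
      rw [← sq_abs]
      exact pow_le_pow_left₀ (abs_nonneg _) (Complex.abs_re_le_norm s) 2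
    have h3 : ε * s.re ^ 2 + l ^ 2 / (4 * ε) - l * s.re = (2 * ε * s.re - l) ^ 2 / (4 * ε) := by
      field_simp
      ring
    have h4 : 0 ≤ (2 * ε * s.re - l) ^ 2 / (4 * ε) := by positivity
    nlinarith [mul_le_mul_of_nonneg_right h1 hs, mul_le_mul_of_nonneg_left h2 hε.le]
  have hG : IntegrableOn G (Ioi 0) := by
    obtain ⟨C, hC⟩ := hO.bound
    have hlog : ∀ᶠ x : ℝ in atTop, ‖Real.log x ^ 2‖ ≤ 2 * ε * p * ‖x‖ :=
      (Real.isLittleO_pow_log_id_atTop (n := 2)).bound (by positivity)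
    obtain ⟨B, hB⟩ := eventually_atTop.1 (hC.and (hlog.and (eventually_ge_atTop 1)))
    have hB1 := (hB B le_rfl).2.2
    rw [← Ioc_union_Ioi_eq_Ioi (zero_le_one.trans hB1)]
    have hGm : AEStronglyMeasurable G (volume.restrict (Ioi 0)) :=
      hwm.aestronglyMeasurable.mul hg'.aestronglyMeasurable
    refine IntegrableOn.union ?_ ?_
    · refine Integrable.mono' ((hg'.mono_set Ioc_subset_Ioi_self).const_mul (w B))
        (hGm.mono_measure (Measure.restrict_mono Ioc_subset_Ioi_self le_rfl)) ?_
      refine (ae_restrict_mem measurableSet_Ioc).mono fun x hx => ?_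
      simp only [G]
      rw [norm_mul, norm_norm, Real.norm_of_nonneg (hw0 x)]
      refine mul_le_mul_of_nonneg_right (Real.exp_le_exp.2 ?_) (norm_nonneg _)
      refine div_le_div_of_nonneg_right (pow_le_pow_left₀ (Real.log_nonneg (le_max_right _ _))
        (Real.log_le_log (by positivity) ?_) 2) (by positivity)
      exact max_le_max hx.2 le_rfl
    · have hsub : Ioi B ⊆ Ioi (0 : ℝ) := Ioi_subset_Ioi (zero_le_one.trans hB1)
      refine Integrable.mono'
        ((integrableOn_exp_mul_Ioi (a := -(p / 2)) (by linarith) B).const_mul C)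
        (hGm.mono_measure (Measure.restrict_mono hsub le_rfl)) ?_
      refine (ae_restrict_mem measurableSet_Ioi).mono fun x hx => ?_
      obtain ⟨h1, h2, h3⟩ := hB x (le_of_lt hx)
      have hx0 : 0 < x := by linarith
      simp only [G]
      rw [norm_mul, norm_norm, Real.norm_of_nonneg (hw0 x), hnorm 0 x hx0, Complex.zero_re,
        zero_sub, Real.rpow_neg_one]
      rw [Real.norm_of_nonneg (Real.exp_nonneg _)] at h1
      rw [Real.norm_of_nonneg (by positivity), Real.norm_of_nonneg hx0.le] at h2
      have h4 : w x ≤ Real.exp (p / 2 * x) := by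
        refine Real.exp_le_exp.2 ?_
        rw [max_eq_left h3, div_le_iff₀ (by positivity)]
        linarith
      have h5 : x⁻¹ * ‖g x‖ ≤ C * Real.exp (-p * x) :=
        (mul_le_of_le_one_left (norm_nonneg _) (inv_le_one_of_one_le₀ h3)).trans h1
      calc w x * (x⁻¹ * ‖g x‖) ≤ Real.exp (p / 2 * x) * (C * Real.exp (-p * x)) :=
            mul_le_mul h4 h5 (by positivity) (Real.exp_nonneg _)
        _ = C * Real.exp (-(p / 2) * x) := by
          rw [mul_left_comm, ← Real.exp_add]
          congr 2
          ring
  refine ⟨∫ x in Ioi 0, G x, fun s hs => ?_⟩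
  rw [mellin, mul_comm, ← integral_const_mul]
  refine norm_integral_le_of_norm_le (hG.const_mul _) ?_
  exact (ae_restrict_mem measurableSet_Ioi).mono fun x hx => hpow s hs x hx

open MeasureTheory Filter Asymptotics Set in
theorem WeakFEPair.hasSubGaussianGrowth_Λ₀ (P : WeakFEPair ℂ)
    (hf : ∃ p, 0 < p ∧ (fun x => P.f x - P.f₀) =O[atTop] fun x => Real.exp (-p * x))
    (hg : ∃ p, 0 < p ∧ (fun x => P.g x - P.g₀) =O[atTop] fun x => Real.exp (-p * x)) :
    HasSubGaussianGrowth P.Λ₀ := by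
  have key : ∀ P' : WeakFEPair ℂ,
      (∃ p, 0 < p ∧ (fun x => P'.f x - P'.f₀) =O[atTop] fun x => Real.exp (-p * x)) →
      ∀ ε : ℝ, 0 < ε → ∃ K : ℝ, ∀ s : ℂ, 0 ≤ s.re → ‖P'.Λ₀ s‖ ≤ K * Real.exp (ε * ‖s‖ ^ 2) := by
    rintro P' ⟨p, hp, hO⟩ ε hε
    refine norm_mellin_le_of_isBigO_exp (P'.isStrongFEPair_toStrongFEPair.hasMellin 0).1 hp ?_ hε
    refine hO.congr' ?_ .rfl
    filter_upwards [eventually_gt_atTop 1] with x hx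
    simp [WeakFEPair.toStrongFEPair, WeakFEPair.f_modif, mem_Ioi.mpr hx, notMem_Ioo_of_ge hx.le]
  intro ε hε
  obtain ⟨K, hK⟩ := key P hf ε hε
  obtain ⟨L, hL⟩ := key P.symm hg (ε / 2) (half_pos hε)
  have hL0 : 0 ≤ L := by
    have := (norm_nonneg _).trans (hL 0 le_rfl)
    simpa using this
  have hK0 : 0 ≤ K := by
    have := (norm_nonneg _).trans (hK 0 le_rfl)
    simpa using this
  refine ⟨K + ‖P.ε‖ * (L * Real.exp (ε * P.k ^ 2)), fun s => ?_⟩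
  rcases le_total 0 s.re with hs | hs
  · refine (hK s hs).trans (mul_le_mul_of_nonneg_right ?_ (Real.exp_nonneg _))
    exact le_add_of_nonneg_right (by positivity)
  · have h1 := P.functional_equation₀ (P.k - s)
    rw [sub_sub_cancel] at h1
    rw [h1, norm_smul, add_mul]
    have h2 := hL (P.k - s) (by simp; linarith [P.hk])
    have h3 : ‖(P.k : ℂ) - s‖ ^ 2 ≤ 2 * P.k ^ 2 + 2 * ‖s‖ ^ 2 := by
      have h4 := norm_sub_le (P.k : ℂ) s
      rw [Complex.norm_real, Real.norm_of_nonneg P.hk.le] at h4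
      have := pow_le_pow_left₀ (norm_nonneg _) h4 2
      nlinarith [sq_nonneg (P.k - ‖s‖)]
    have h5 : L * Real.exp (ε / 2 * ‖(P.k : ℂ) - s‖ ^ 2) ≤
        L * Real.exp (ε * P.k ^ 2) * Real.exp (ε * ‖s‖ ^ 2) := by
      rw [mul_assoc, ← Real.exp_add]
      refine mul_le_mul_of_nonneg_left (Real.exp_le_exp.2 ?_) hL0
      nlinarith
    have h6 : 0 ≤ K * Real.exp (ε * ‖s‖ ^ 2) := by positivity
    have h7 := mul_le_mul_of_nonneg_left (h2.trans h5) (norm_nonneg P.ε)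
    rw [← mul_assoc] at h7
    linarith

open Filter Asymptotics HurwitzZeta

theorem hasSubGaussianGrowth_completedHurwitzZetaEven₀ (a : UnitAddCircle) :
    HasSubGaussianGrowth (completedHurwitzZetaEven₀ a) := by
  have h := (hurwitzEvenFEPair a).hasSubGaussianGrowth_Λ₀
    (by
      obtain ⟨p, hp, h⟩ := isBigO_atTop_evenKernel_sub a
      refine ⟨p, hp, ?_⟩
      rw [← isBigO_norm_left] at h ⊢
      conv at h =>
        enter [2, x]
        rw [← norm_real, ofReal_sub, apply_ite ((↑) : ℝ → ℂ), ofReal_one, ofReal_zero]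
      exact h)
    (by
      obtain ⟨p, hp, h⟩ := isBigO_atTop_cosKernel_sub a
      refine ⟨p, hp, ?_⟩
      simpa [hurwitzEvenFEPair] using isBigO_ofReal_left.mpr h)
  have h2 := (h.comp_affine (1 / 2) 0).mul (.const (1 / 2))
  convert h2 using 2 with z
  rw [completedHurwitzZetaEven₀]
  ring_nf

theorem hasSubGaussianGrowth_completedHurwitzZetaOdd (a : UnitAddCircle) :
    HasSubGaussianGrowth (completedHurwitzZetaOdd a) := by
  have h := (hurwitzOddFEPair a).hasSubGaussianGrowth_Λ₀
    (by
      obtain ⟨p, hp, h⟩ := isBigO_atTop_oddKernel a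
      refine ⟨p, hp, ?_⟩
      simpa [hurwitzOddFEPair] using isBigO_ofReal_left.mpr h)
    (by
      obtain ⟨p, hp, h⟩ := isBigO_atTop_sinKernel a
      refine ⟨p, hp, ?_⟩
      simpa [hurwitzOddFEPair] using isBigO_ofReal_left.mpr h)
  have h2 := (h.comp_affine (1 / 2) (1 / 2)).mul (.const (1 / 2))
  convert h2 using 2 with z
  rw [completedHurwitzZetaOdd, WeakFEPair.Λ]
  simp only [hurwitzOddFEPair, smul_zero, sub_zero]
  ring_nf

theorem ZMod.hasSubGaussianGrowth_completedLFunction₀ {N : ℕ} [NeZero N] (Φ : ZMod N → ℂ) :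
    HasSubGaussianGrowth (ZMod.completedLFunction₀ Φ) := by
  have hN : HasSubGaussianGrowth fun s => (N : ℂ) ^ (-s) := by
    have := HasSubGaussianGrowth.natCast_cpow (NeZero.ne N) (-1)
    simpa using this
  exact (hN.mul (.sum fun j _ =>
      (HasSubGaussianGrowth.const _).mul (hasSubGaussianGrowth_completedHurwitzZetaEven₀ _))).add
    (hN.mul (.sum fun j _ =>
      (HasSubGaussianGrowth.const _).mul (hasSubGaussianGrowth_completedHurwitzZetaOdd _)))

theorem hasSubGaussianGrowth_completedRiemannZeta₀ :
    HasSubGaussianGrowth completedRiemannZeta₀ :=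
  hasSubGaussianGrowth_completedHurwitzZetaEven₀ 0

end SubGaussianGrowth

section CompletedFunctions

open Complex ComplexConjugate DirichletCharacter

theorem map_conj_eq_conj_of_one_lt_re {f g : ℂ → ℂ} (hf : Differentiable ℂ f)
    (hg : Differentiable ℂ g) (h : ∀ s : ℂ, 1 < s.re → g (conj s) = conj (f s)) (s : ℂ) :
    g (conj s) = conj (f s) := by
  have hf' : Differentiable ℂ (conj ∘ f ∘ conj) := fun z => by
    simpa using (hf (conj z)).conj_conj
  have key : g = conj ∘ f ∘ conj := by
    refine AnalyticOnNhd.eq_of_eventuallyEq (𝕜 := ℂ) (z₀ := 2)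
      (hg.differentiableOn.analyticOnNhd isOpen_univ)
      (hf'.differentiableOn.analyticOnNhd isOpen_univ) ?_
    refine Filter.eventually_of_mem
      ((continuous_re.isOpen_preimage _ isOpen_Ioi).mem_nhds (by simp : 1 < (2 : ℂ).re))
      fun t (ht : 1 < t.re) => ?_
    have := h (conj t) (by simpa using ht)
    simpa using this
  simp [key]

theorem Complex.Gammaℝ_conj (s : ℂ) : Gammaℝ (conj s) = conj (Gammaℝ s) := by
  have h : -conj s / 2 = conj (-s / 2) := by simp [map_ofNat]
  rw [Gammaℝ_def, Gammaℝ_def, map_mul, ← Complex.Gamma_conj, h,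
    cpow_conj _ _ (by rw [arg_ofReal_of_nonneg pi_pos.le]; exact pi_pos.ne), conj_ofReal]
  simp [map_ofNat]

theorem Complex.natCast_cpow_conj (n : ℕ) (s : ℂ) : (n : ℂ) ^ conj s = conj ((n : ℂ) ^ s) := by
  rw [cpow_conj _ _ (by rw [natCast_arg]; exact pi_pos.ne), map_natCast]

namespace DirichletCharacter

variable {n : ℕ} [NeZero n] (χ : DirichletCharacter ℂ n)

omit [NeZero n] in
theorem gammaFactor_inv_conj (s : ℂ) : gammaFactor χ⁻¹ (conj s) = conj (gammaFactor χ s) := by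
  have h : χ⁻¹ (-1) = χ (-1) := by
    rw [← MulChar.star_apply']
    rcases χ.even_or_odd with h | h <;> simp only [Even, Odd] at h <;> simp [h]
  rcases χ.even_or_odd with hχ | hχ
  · have : χ⁻¹.Even := by rw [Even, h]; exact hχ
    rw [this.gammaFactor_def, hχ.gammaFactor_def, Gammaℝ_conj]
  · have : χ⁻¹.Odd := by rw [Odd, h]; exact hχ
    rw [this.gammaFactor_def, hχ.gammaFactor_def, ← Gammaℝ_conj]
    simp

theorem LFunction_inv_conj_of_one_lt_re {s : ℂ} (hs : 1 < s.re) :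
    LFunction χ⁻¹ (conj s) = conj (LFunction χ s) := by
  rw [LFunction_eq_LSeries _ hs, LFunction_eq_LSeries _ (by simpa using hs), LSeries, LSeries,
    conj_tsum]
  refine tsum_congr fun k => ?_
  rcases eq_or_ne k 0 with rfl | hk
  · simp
  · rw [LSeries.term_of_ne_zero hk, LSeries.term_of_ne_zero hk, map_div₀, natCast_cpow_conj,
      ← MulChar.star_apply']
    rfl

variable {χ}

theorem LFunction_inv_conj (hχ : χ ≠ 1) (s : ℂ) :
    LFunction χ⁻¹ (conj s) = conj (LFunction χ s) :=
  map_conj_eq_conj_of_one_lt_re (differentiable_LFunction hχ)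
    (differentiable_LFunction (by simpa using hχ))
    (fun _ => LFunction_inv_conj_of_one_lt_re χ) s

omit [NeZero n] in
theorem gammaFactor_ne_zero_of_re_pos (χ : DirichletCharacter ℂ n) {s : ℂ} (hs : 0 < s.re) :
    gammaFactor χ s ≠ 0 := by
  rcases χ.even_or_odd with hχ | hχ <;> rw [hχ.gammaFactor_def]
  · exact Gammaℝ_ne_zero_of_re_pos hs
  · exact Gammaℝ_ne_zero_of_re_pos (by simp; linarith)

theorem completedLFunction_eq_gammaFactor_mul (χ : DirichletCharacter ℂ n) {s : ℂ}
    (hs : 0 < s.re) : completedLFunction χ s = gammaFactor χ s * LFunction χ s := by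
  rw [LFunction_eq_completed_div_gammaFactor χ s (.inl (by rintro rfl; simp at hs)),
    mul_div_cancel₀ _ (gammaFactor_ne_zero_of_re_pos χ hs)]

theorem completedLFunction_inv_conj (hχ : χ ≠ 1) (s : ℂ) :
    completedLFunction χ⁻¹ (conj s) = conj (completedLFunction χ s) := by
  refine map_conj_eq_conj_of_one_lt_re (differentiable_completedLFunction hχ)
    (differentiable_completedLFunction (by simpa using hχ)) (fun s hs => ?_) s
  rw [completedLFunction_eq_gammaFactor_mul (s := conj s) _ (by rw [conj_re]; linarith),
    completedLFunction_eq_gammaFactor_mul _ (by linarith), map_mul,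
    gammaFactor_inv_conj, LFunction_inv_conj_of_one_lt_re χ hs]

theorem hasSubGaussianGrowth_completedLFunction (hχ : χ ≠ 1) :
    HasSubGaussianGrowth (completedLFunction χ) := by
  have h : completedLFunction χ = ZMod.completedLFunction₀ χ := by
    ext s
    have hn : n ≠ 1 := hχ ∘ level_one' _
    rw [completedLFunction, ZMod.completedLFunction_eq, χ.map_zero' hn,
      χ.sum_eq_zero_of_ne_one hχ]
    simp
  rw [h]
  exact ZMod.hasSubGaussianGrowth_completedLFunction₀ _

theorem LFunction_ne_zero_of_one_lt_re (χ : DirichletCharacter ℂ n) {s : ℂ} (hs : 1 < s.re) :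
    LFunction χ s ≠ 0 :=
  LFunction_ne_zero_of_one_le_re χ (.inr (by rintro rfl; simp at hs)) hs.le

theorem natCast_cpow_mul_completedLFunction_one_sub_conj (hχ : χ ≠ 1) (hp : χ.IsPrimitive)
    (s : ℂ) :
    (n : ℂ) ^ (1 / 2 * (1 - conj s)) * completedLFunction χ (1 - conj s) =
      rootNumber χ * conj ((n : ℂ) ^ (1 / 2 * s) * completedLFunction χ s) := by
  have hn : (n : ℂ) ≠ 0 := NeZero.ne _
  rw [hp.completedLFunction_one_sub, completedLFunction_inv_conj hχ, map_mul, ← natCast_cpow_conj,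
    ← mul_assoc, ← mul_assoc, ← cpow_add _ _ hn]
  simp only [map_mul, map_div₀, map_one, map_ofNat]
  ring_nf

theorem rootNumber_ne_zero_of_isPrimitive (hχ : χ ≠ 1) (hp : χ.IsPrimitive) :
    rootNumber χ ≠ 0 := by
  intro h
  have := natCast_cpow_mul_completedLFunction_one_sub_conj hχ hp (conj (1 - 2))
  rw [h, zero_mul, conj_conj, sub_sub_cancel,
    completedLFunction_eq_gammaFactor_mul _ (by simp)] at this
  refine mul_ne_zero ?_ (mul_ne_zero (gammaFactor_ne_zero_of_re_pos χ (by simp))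
    (LFunction_ne_zero_of_one_lt_re χ (by simp))) this
  simp [NeZero.ne]

end DirichletCharacter

theorem Complex.logDeriv_Gammaℝ_re_le {w : ℂ} (hw : 0 < w.re) :
    (logDeriv Gammaℝ w).re ≤ 1 / 2 * Real.log ((1 + w.re / 2 + |w.im|) / π) := by
  have hw2 : 0 < (w / 2).re := by simpa using hw
  have hne : ∀ m : ℕ, w / 2 ≠ -m := fun m h => by
    have := congrArg re h
    simp at this hw2
    linarith [m.cast_nonneg (α := ℝ)]
  have hΓ : DifferentiableAt ℂ Complex.Gamma (w / 2) := differentiableAt_Gamma _ hne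
  have hd : DifferentiableAt ℂ (fun s : ℂ => s / 2) w := by fun_prop
  have h1 : HasDerivAt (fun s : ℂ => (π : ℂ) ^ (-s / 2))
      ((π : ℂ) ^ (-w / 2) * Complex.log π * (-1 / 2)) w := by
    have : HasDerivAt (fun s : ℂ => -s / 2) (-1 / 2) w := ((hasDerivAt_id w).neg).div_const 2
    exact this.const_cpow (.inl (ofReal_ne_zero.mpr pi_ne_zero))
  have hπ : (π : ℂ) ^ (-w / 2) ≠ 0 := by simp [pi_ne_zero]
  have hG : logDeriv Gammaℝ w = _ :=
    logDeriv_mul (f := fun s : ℂ => (π : ℂ) ^ (-s / 2)) (g := Complex.Gamma ∘ fun s => s / 2)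
      w hπ (Complex.Gamma_ne_zero hne) h1.differentiableAt (hΓ.comp w hd)
  rw [hG, logDeriv_comp (g := fun s : ℂ => s / 2) hΓ hd, logDeriv_apply, h1.deriv]
  have h2 : deriv (fun s : ℂ => s / 2) w = 1 / 2 := by simp
  rw [h2, mul_assoc, mul_div_cancel_left₀ _ hπ, ← ofReal_log pi_pos.le]
  have h3 := re_logDeriv_Gamma_le hw2
  have h4 : (1 + (w / 2).re + 2 * |(w / 2).im|) = 1 + w.re / 2 + |w.im| := by
    have hi : (w / 2).im = w.im / 2 := by simp
    have hr : (w / 2).re = w.re / 2 := by simp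
    rw [hi, hr, abs_div, abs_of_pos (two_pos : (0 : ℝ) < 2)]
    ring
  rw [h4] at h3
  have h5 : 0 < 1 + w.re / 2 + |w.im| := by positivity
  rw [Real.log_div h5.ne' pi_ne_zero]
  have e1 : ((Real.log π : ℂ) * (-1 / 2)).re = - Real.log π / 2 := by
    have : (-1 / 2 : ℂ) = ((-1 / 2 : ℝ) : ℂ) := by push_cast; ring
    rw [this, ← ofReal_mul, ofReal_re]; ring
  have e2 : (logDeriv Complex.Gamma (w / 2) * (1 / 2)).re
      = (logDeriv Complex.Gamma (w / 2)).re / 2 := by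
    have : (1 / 2 : ℂ) = ((1 / 2 : ℝ) : ℂ) := by push_cast; ring
    rw [this, re_mul_ofReal]; ring
  rw [add_re, e1, e2]
  linarith

end CompletedFunctions

section ZeroSums

open Complex ComplexConjugate DirichletCharacter

theorem Complex.differentiableAt_Gammaℝ {s : ℂ} (hs : 0 < s.re) :
    DifferentiableAt ℂ Gammaℝ s := by
  have := (differentiable_Gammaℝ_inv s).inv (inv_ne_zero (Gammaℝ_ne_zero_of_re_pos hs))
  rwa [Pi.inv_def, funext fun z : ℂ => inv_inv (Gammaℝ z)] at this

theorem Filter.EventuallyEq.logDeriv_eq {f g : ℂ → ℂ} {s : ℂ} (h : f =ᶠ[nhds s] g) :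
    logDeriv f s = logDeriv g s := by
  rw [logDeriv_apply, logDeriv_apply, h.deriv_eq, h.self_of_nhds]

theorem Complex.eventually_re_pos {s : ℂ} (hs : 0 < s.re) : ∀ᶠ z in nhds s, 0 < z.re :=
  (continuous_re.isOpen_preimage _ isOpen_Ioi).mem_nhds hs

namespace DirichletCharacter

variable {n : ℕ} (χ : DirichletCharacter ℂ n)

theorem differentiableAt_gammaFactor {s : ℂ} (hs : 0 < s.re) :
    DifferentiableAt ℂ (gammaFactor χ) s := by
  rcases χ.even_or_odd with hχ | hχ
  · rw [funext hχ.gammaFactor_def]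
    exact differentiableAt_Gammaℝ hs
  · rw [funext hχ.gammaFactor_def]
    exact DifferentiableAt.comp (g := Gammaℝ) (f := fun z : ℂ => z + 1) s
      (differentiableAt_Gammaℝ (by simp; linarith)) (by fun_prop)

theorem re_logDeriv_gammaFactor_le {s : ℂ} (hs : 0 < s.re) (hs' : s.re ≤ 1.04) :
    (logDeriv (gammaFactor χ) s).re ≤ 1 / 2 * Real.log ((2.02 + |s.im|) / π) := by
  have hmono : ∀ w : ℂ, 0 < w.re → w.re ≤ 2.04 → w.im = s.im →
      (logDeriv Gammaℝ w).re ≤ 1 / 2 * Real.log ((2.02 + |s.im|) / π) := by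
    intro w hw hw' hi
    refine (logDeriv_Gammaℝ_re_le hw).trans ?_
    rw [hi]
    have := pi_pos
    gcongr
    linarith
  rcases χ.even_or_odd with hχ | hχ
  · rw [funext hχ.gammaFactor_def]
    exact hmono s hs (by linarith) rfl
  · rw [funext hχ.gammaFactor_def, logDeriv_apply, deriv_comp_add_const, ← logDeriv_apply]
    exact hmono (s + 1) (by simp; linarith) (by simp; linarith) (by simp)

variable {χ} [NeZero n]

theorem sum_zeros_le_of_ne_one (hχ : χ ≠ 1) (hp : χ.IsPrimitive) {s : ℂ} (hs : 1 < s.re)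
    (hs' : s.re ≤ 1.04) {F : Finset ℂ} (hF : ∀ ρ ∈ F, LFunction χ ρ = 0 ∧ 1 / 2 < ρ.re) :
    ∑ ρ ∈ F, (1 / (s - ρ)).re ≤ (logDeriv (LFunction χ) s).re
      + 1 / 2 * Real.log (n * (2.02 + |s.im|) / π) := by
  have hs0 : 0 < s.re := by linarith
  have hn : (n : ℂ) ≠ 0 := NeZero.ne _
  have hcp : Differentiable ℂ fun s : ℂ => (n : ℂ) ^ (1 / 2 * s) := by fun_prop
  have h := sum_zeros_le_re_logDeriv (f := fun s => (n : ℂ) ^ (1 / 2 * s) * completedLFunction χ s)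
    (hcp.mul (differentiable_completedLFunction hχ))
    ((HasSubGaussianGrowth.natCast_cpow (NeZero.ne n) _).mul
      (hasSubGaussianGrowth_completedLFunction hχ))
    (rootNumber_ne_zero_of_isPrimitive hχ hp)
    (natCast_cpow_mul_completedLFunction_one_sub_conj hχ hp)
    (fun s hs => mul_ne_zero (by simp [hn]) (by
      rw [completedLFunction_eq_gammaFactor_mul _ (by linarith)]
      exact mul_ne_zero (gammaFactor_ne_zero_of_re_pos χ (by linarith))
        (LFunction_ne_zero_of_one_lt_re χ hs))) hs (F := F)
    (fun ρ hρ => by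
      obtain ⟨h0, h1⟩ := hF ρ hρ
      refine ⟨?_, h1⟩
      rw [completedLFunction_eq_gammaFactor_mul _ (by linarith), h0, mul_zero, mul_zero])
  refine h.trans ?_
  have hev : (fun s => (n : ℂ) ^ (1 / 2 * s) * completedLFunction χ s) =ᶠ[nhds s]
      fun s => (n : ℂ) ^ (1 / 2 * s) * (gammaFactor χ s * LFunction χ s) := by
    filter_upwards [eventually_re_pos hs0] with z hz
    rw [completedLFunction_eq_gammaFactor_mul _ hz]
  have hL0 := LFunction_ne_zero_of_one_lt_re χ hs
  have hg0 := gammaFactor_ne_zero_of_re_pos χ hs0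
  have hLd := differentiable_LFunction hχ s
  have hgd := differentiableAt_gammaFactor χ hs0
  rw [hev.logDeriv_eq, logDeriv_mul (f := fun s : ℂ => (n : ℂ) ^ (1 / 2 * s))
    (g := fun s => gammaFactor χ s * LFunction χ s) s (by simp [hn]) (mul_ne_zero hg0 hL0) (hcp s)
    (hgd.mul hLd), logDeriv_mul s hg0 hL0 hgd hLd, add_re, add_re]
  have h1 : (logDeriv (fun s : ℂ => (n : ℂ) ^ (1 / 2 * s)) s).re = 1 / 2 * Real.log n := by
    have hd : HasDerivAt (fun s : ℂ => (n : ℂ) ^ (1 / 2 * s))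
        ((n : ℂ) ^ (1 / 2 * s) * Complex.log n * (1 / 2 * 1)) s :=
      ((hasDerivAt_id s).const_mul (1 / 2 : ℂ)).const_cpow (.inl hn)
    rw [logDeriv_apply, hd.deriv, mul_assoc, mul_div_cancel_left₀ _ (by simp [hn]),
      ← natCast_log]
    have : (Real.log n : ℂ) * (1 / 2 * 1) = ((1 / 2 * Real.log n : ℝ) : ℂ) := by push_cast; ring
    rw [this, ofReal_re]
  have h2 := re_logDeriv_gammaFactor_le χ hs0 hs'
  have h3 : Real.log (n * (2.02 + |s.im|) / π) = Real.log n + Real.log ((2.02 + |s.im|) / π) := by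
    rw [mul_div_assoc, Real.log_mul (by exact_mod_cast NeZero.ne n)]
    positivity
  rw [h1, h3]
  linarith

end DirichletCharacter

theorem completedRiemannZeta₀_conj (s : ℂ) :
    completedRiemannZeta₀ (conj s) = conj (completedRiemannZeta₀ s) := by
  refine map_conj_eq_conj_of_one_lt_re differentiable_completedZeta₀ differentiable_completedZeta₀
    (fun s hs => ?_) s
  have key : ∀ s : ℂ, 1 < s.re →
      completedRiemannZeta₀ s = Gammaℝ s * riemannZeta s + 1 / s + 1 / (1 - s) := fun s hs => by
    have hs0 : s ≠ 0 := by rintro rfl; simp at hs; linarith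
    rw [riemannZeta_def_of_ne_zero hs0, mul_div_cancel₀ _ (Gammaℝ_ne_zero_of_re_pos (by linarith)),
      completedRiemannZeta_eq]
    ring
  have hζ : riemannZeta (conj s) = conj (riemannZeta s) := by
    have := LFunction_inv_conj_of_one_lt_re (1 : DirichletCharacter ℂ 1) hs
    rwa [LFunction_modOne_eq, LFunction_modOne_eq] at this
  rw [key _ hs, key _ (by simpa using hs), Gammaℝ_conj, hζ]
  simp

theorem sum_zeros_riemannZeta_le {s : ℂ} (hs : 1 < s.re) (hs' : s.re ≤ 1.04) {F : Finset ℂ}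
    (hF : ∀ ρ ∈ F, riemannZeta ρ = 0 ∧ 1 / 2 < ρ.re) :
    ∑ ρ ∈ F, (1 / (s - ρ)).re ≤ (logDeriv riemannZeta s).re
      + 1 / 2 * Real.log ((2.02 + |s.im|) / π) + (1 / (s - 1)).re + 1 := by
  set g : ℂ → ℂ := fun s => s * (1 - s) * completedRiemannZeta₀ s - 1 with hg
  have hgd : Differentiable ℂ g := by
    have := differentiable_completedZeta₀
    fun_prop
  have hgeq : ∀ z : ℂ, 0 < z.re → z ≠ 1 → g z = z * (1 - z) * (Gammaℝ z * riemannZeta z) := by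
    intro z hz hz1
    have hz0 : z ≠ 0 := by rintro rfl; simp at hz
    have hz1' : 1 - z ≠ 0 := sub_ne_zero.mpr hz1.symm
    rw [riemannZeta_def_of_ne_zero hz0, mul_div_cancel₀ _ (Gammaℝ_ne_zero_of_re_pos hz),
      completedRiemannZeta_eq, hg]
    field_simp
    ring
  have hone : ∀ z : ℂ, 1 < z.re → z ≠ 1 := by rintro z hz rfl; simp at hz
  have h := sum_zeros_le_re_logDeriv (f := g) hgd
    (by
      have h1 : HasSubGaussianGrowth fun z => z * (1 - z) := by
        simpa [sub_eq_neg_add] using HasSubGaussianGrowth.id.mul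
          (HasSubGaussianGrowth.id.comp_affine (-1) 1)
      simpa [hg, sub_eq_add_neg] using
        (h1.mul hasSubGaussianGrowth_completedRiemannZeta₀).add (.const (-1)))
    (one_ne_zero)
    (fun z => by
      simp only [hg, completedRiemannZeta₀_one_sub, completedRiemannZeta₀_conj, map_sub, map_mul,
        map_one]
      ring)
    (fun z hz => by
      rw [hgeq z (by linarith) (hone z hz)]
      refine mul_ne_zero (mul_ne_zero ?_ (sub_ne_zero.mpr (hone z hz).symm)) (mul_ne_zero
        (Gammaℝ_ne_zero_of_re_pos (by linarith)) (riemannZeta_ne_zero_of_one_lt_re hz))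
      rintro rfl; simp at hz; linarith) hs (F := F)
    (fun ρ hρ => by
      obtain ⟨h0, h1⟩ := hF ρ hρ
      refine ⟨?_, h1⟩
      have hρ1 : ρ ≠ 1 := by
        rintro rfl
        exact riemannZeta_ne_zero_of_one_le_re (by simp) h0
      rw [hgeq ρ (by linarith) hρ1, h0, mul_zero, mul_zero])
  refine h.trans ?_
  have hs0 : 0 < s.re := by linarith
  have hsne : s ≠ 0 := by rintro rfl; simp at hs0
  have hs1 : 1 - s ≠ 0 := sub_ne_zero.mpr (hone s hs).symm
  have hev : g =ᶠ[nhds s] fun z => z * (1 - z) * (Gammaℝ z * riemannZeta z) := by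
    filter_upwards [eventually_re_pos hs0, eventually_ne_nhds (hone s hs)] with z hz hz1
    exact hgeq z hz hz1
  have hL0 := riemannZeta_ne_zero_of_one_lt_re hs
  have hg0 := Gammaℝ_ne_zero_of_re_pos hs0
  have hLd := differentiableAt_riemannZeta (hone s hs)
  have hGd := differentiableAt_Gammaℝ hs0
  rw [hev.logDeriv_eq, logDeriv_mul (f := fun z : ℂ => z * (1 - z))
    (g := fun z => Gammaℝ z * riemannZeta z) s (mul_ne_zero hsne hs1) (mul_ne_zero hg0 hL0)
    (by fun_prop)
    (hGd.mul hLd), logDeriv_mul s hg0 hL0 hGd hLd,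
    logDeriv_mul (f := fun z : ℂ => z) (g := fun z : ℂ => 1 - z) s hsne hs1 (by fun_prop)
    (by fun_prop)]
  have h1 : logDeriv (fun z : ℂ => 1 - z) s = 1 / (s - 1) := by
    rw [logDeriv_apply, deriv_const_sub, deriv_id'', neg_div, ← div_neg, neg_sub]
  have h2 : (logDeriv (fun z : ℂ => z) s).re ≤ 1 := by
    rw [logDeriv_apply, deriv_id'']
    refine (re_le_norm _).trans ?_
    rw [norm_div, norm_one]
    exact div_le_one_of_le₀ (hs.le.trans (re_le_norm s)) (norm_nonneg _)
  have h3 : (logDeriv Gammaℝ s).re ≤ 1 / 2 * Real.log ((2.02 + |s.im|) / π) := by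
    refine (logDeriv_Gammaℝ_re_le hs0).trans ?_
    have := pi_pos
    gcongr
    linarith
  rw [h1, add_re, add_re, add_re]
  linarith

end ZeroSums

section Positivity

open Complex ComplexConjugate DirichletCharacter ArithmeticFunction

namespace DirichletCharacter

variable {n : ℕ} [NeZero n]

theorem hasSum_re_logDeriv_LFunction (χ : DirichletCharacter ℂ n) {σ : ℝ} (hσ : 1 < σ) (t : ℝ) :
    HasSum (fun k : ℕ => Λ k * (k : ℝ) ^ (-σ) * (χ k * (k : ℂ) ^ (-(t * I))).re)
      (-(logDeriv (LFunction χ) (σ + t * I)).re) := by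
  have hs : 1 < ((σ : ℂ) + t * I).re := by simpa using hσ
  have h := (LSeriesSummable_twist_vonMangoldt χ hs).hasSum
  change HasSum _ (LSeries _ _) at h
  rw [LSeries_twist_vonMangoldt_eq χ hs, ← LFunction_eq_LSeries χ hs,
    ← deriv_LFunction_eq_deriv_LSeries χ hs, neg_div, ← logDeriv_apply] at h
  have h' := hasSum_re h
  rw [neg_re] at h'
  convert h' using 1
  ext k
  rcases eq_or_ne k 0 with rfl | hk
  · simp
  have hk' : (k : ℂ) ≠ 0 := Nat.cast_ne_zero.mpr hk
  rw [LSeries.term_of_ne_zero hk, cpow_add _ _ hk', Pi.mul_apply, cpow_neg,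
    Real.rpow_neg (Nat.cast_nonneg k), ← re_ofReal_mul]
  congr 1
  push_cast [ofReal_cpow (Nat.cast_nonneg k)]
  field_simp

theorem hasSum_re_logDeriv_LFunction_ofReal (χ : DirichletCharacter ℂ n) {σ : ℝ} (hσ : 1 < σ) :
    HasSum (fun k : ℕ => Λ k * (k : ℝ) ^ (-σ) * (χ k).re) (-(logDeriv (LFunction χ) σ).re) := by
  simpa using hasSum_re_logDeriv_LFunction χ hσ 0

end DirichletCharacter

theorem hasSum_re_logDeriv_riemannZeta {σ : ℝ} (hσ : 1 < σ) :
    HasSum (fun k : ℕ => Λ k * (k : ℝ) ^ (-σ)) (-(logDeriv riemannZeta σ).re) := by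
  have h := DirichletCharacter.hasSum_re_logDeriv_LFunction_ofReal (1 : DirichletCharacter ℂ 1) hσ
  rw [LFunction_modOne_eq] at h
  convert h using 2 with k
  rw [Subsingleton.elim (k : ZMod 1) 1, map_one, one_re, mul_one]

theorem five_add_eight_mul_re_add_nonneg {z : ℂ} (hz : ‖z‖ = 1) :
    0 ≤ 5 + 8 * z.re + 4 * (z ^ 2).re + (z ^ 3).re := by
  have h : z.re ^ 2 + z.im ^ 2 = 1 := by
    have := Complex.sq_norm z
    rw [hz, normSq_apply] at this
    linarith
  have h2 : (z ^ 2).re = 2 * z.re ^ 2 - 1 := by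
    rw [pow_two, mul_re]
    linear_combination -h
  have h3 : (z ^ 3).re = 4 * z.re ^ 3 - 3 * z.re := by
    rw [pow_succ, pow_two, mul_re, mul_re, mul_im]
    linear_combination (-3 * z.re) * h
  have h1 : 0 ≤ 1 + z.re := by nlinarith [sq_nonneg z.im]
  rw [h2, h3]
  nlinarith [mul_nonneg h1 (sq_nonneg (1 + 2 * z.re))]

theorem Complex.norm_natCast_cpow_neg_mul_I {k : ℕ} (hk : k ≠ 0) (t : ℝ) :
    ‖(k : ℂ) ^ (-(t * I))‖ = 1 := by
  rw [norm_natCast_cpow_of_pos (Nat.pos_of_ne_zero hk)]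
  simp

theorem Complex.natCast_cpow_neg_mul_I_pow (k m : ℕ) (t : ℝ) :
    (k : ℂ) ^ (-((m * t : ℝ) * I)) = ((k : ℂ) ^ (-(t * I))) ^ m := by
  rw [← cpow_nat_mul]
  congr 1
  push_cast
  ring

namespace DirichletCharacter

theorem norm_apply_natCast_mul_cpow_le {n : ℕ} (χ : DirichletCharacter ℂ n) {k : ℕ} (hk : k ≠ 0)
    (t : ℝ) : |(χ k * (k : ℂ) ^ (-(t * I))).re| ≤ 1 := by
  refine (abs_re_le_norm _).trans ?_
  rw [norm_mul, norm_natCast_cpow_neg_mul_I hk, mul_one]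
  exact χ.norm_le_one _

theorem five_eight_four_one_inequality {n n₂ n₃ : ℕ} [NeZero n] [NeZero n₂] [NeZero n₃]
    (χ : DirichletCharacter ℂ n) (χ₂ : DirichletCharacter ℂ n₂) (χ₃ : DirichletCharacter ℂ n₃)
    (h₂ : ∀ k : ℕ, k.Coprime n → χ₂ k = χ k ^ 2) (h₃ : ∀ k : ℕ, k.Coprime n → χ₃ k = χ k ^ 3)
    {σ : ℝ} (hσ : 1 < σ) (t : ℝ) :
    5 * (logDeriv riemannZeta σ).re + 8 * (logDeriv (LFunction χ) (σ + t * I)).re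
      + 4 * (logDeriv (LFunction χ₂) (σ + (2 * t : ℝ) * I)).re
      + (logDeriv (LFunction χ₃) (σ + (3 * t : ℝ) * I)).re ≤ 0 := by
  have H := ((((hasSum_re_logDeriv_riemannZeta hσ).mul_left 5).add
    ((hasSum_re_logDeriv_LFunction χ hσ t).mul_left 8)).add
    ((hasSum_re_logDeriv_LFunction χ₂ hσ (2 * t)).mul_left 4)).add
    (hasSum_re_logDeriv_LFunction χ₃ hσ (3 * t))
  have := H.nonneg fun k => ?_
  · linarith
  rcases eq_or_ne k 0 with rfl | hk
  · simp
  have hΛ : 0 ≤ Λ k * (k : ℝ) ^ (-σ) := mul_nonneg vonMangoldt_nonneg (by positivity)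
  have key : 0 ≤ 5 + 8 * (χ k * (k : ℂ) ^ (-(t * I))).re
      + 4 * (χ₂ k * (k : ℂ) ^ (-((2 * t : ℝ) * I))).re
      + (χ₃ k * (k : ℂ) ^ (-((3 * t : ℝ) * I))).re := by
    by_cases hc : k.Coprime n
    · have e2 := natCast_cpow_neg_mul_I_pow k 2 t
      have e3 := natCast_cpow_neg_mul_I_pow k 3 t
      push_cast at e2 e3 ⊢
      rw [h₂ k hc, h₃ k hc, e2, e3, ← mul_pow, ← mul_pow]
      refine five_add_eight_mul_re_add_nonneg ?_
      rw [norm_mul, norm_natCast_cpow_neg_mul_I hk, mul_one]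
      exact χ.unit_norm_eq_one (ZMod.unitOfCoprime k hc)
    · have hχ : χ k = 0 := χ.map_nonunit (by rwa [ZMod.isUnit_iff_coprime])
      have b2 := abs_le.mp (norm_apply_natCast_mul_cpow_le χ₂ hk (2 * t))
      have b3 := abs_le.mp (norm_apply_natCast_mul_cpow_le χ₃ hk (3 * t))
      rw [hχ, zero_mul, zero_re]
      linarith [b2.1, b3.1]
  refine (mul_nonneg hΛ key).trans_eq ?_
  ring

theorem one_one_inequality {n : ℕ} [NeZero n] (χ : DirichletCharacter ℂ n) {σ : ℝ} (hσ : 1 < σ) :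
    (logDeriv riemannZeta σ).re + (logDeriv (LFunction χ) σ).re ≤ 0 := by
  have := ((hasSum_re_logDeriv_riemannZeta hσ).add
    (hasSum_re_logDeriv_LFunction_ofReal χ hσ)).nonneg fun k => ?_
  · linarith
  have hΛ : 0 ≤ Λ k * (k : ℝ) ^ (-σ) := mul_nonneg vonMangoldt_nonneg (by positivity)
  have b := abs_le.mp ((abs_re_le_norm _).trans (χ.norm_le_one k))
  rw [← mul_one_add]
  exact mul_nonneg hΛ (by linarith [b.1])

theorem one_one_one_one_inequality {n₁ n₂ m : ℕ} [NeZero n₁] [NeZero n₂] [NeZero m]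
    (χ₁ : DirichletCharacter ℂ n₁) (χ₂ : DirichletCharacter ℂ n₂) (χ₃ : DirichletCharacter ℂ m)
    (h : ∀ k : ℕ, Λ k ≠ 0 → 0 ≤ 1 + (χ₁ k).re + (χ₂ k).re + (χ₃ k).re) {σ : ℝ} (hσ : 1 < σ) :
    (logDeriv riemannZeta σ).re + (logDeriv (LFunction χ₁) σ).re
      + (logDeriv (LFunction χ₂) σ).re + (logDeriv (LFunction χ₃) σ).re ≤ 0 := by
  have := ((((hasSum_re_logDeriv_riemannZeta hσ).add
    (hasSum_re_logDeriv_LFunction_ofReal χ₁ hσ)).add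
    (hasSum_re_logDeriv_LFunction_ofReal χ₂ hσ)).add
    (hasSum_re_logDeriv_LFunction_ofReal χ₃ hσ)).nonneg fun k => ?_
  · linarith
  by_cases hΛ0 : Λ k = 0
  · simp [hΛ0]
  have hΛ : 0 ≤ Λ k * (k : ℝ) ^ (-σ) := mul_nonneg vonMangoldt_nonneg (by positivity)
  rw [← mul_one_add, ← mul_add, ← mul_add]
  exact mul_nonneg hΛ (h k hΛ0)

end DirichletCharacter

end Positivity

section ZeroFreeRegion

open Complex ComplexConjugate DirichletCharacter

theorem Complex.re_one_div_sub_eq {σ t u : ℝ} {ρ : ℂ} (hu : u ^ 2 = (t - ρ.im) ^ 2) :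
    (1 / ((σ : ℂ) + t * I - ρ)).re = (σ - ρ.re) / ((σ - ρ.re) ^ 2 + u ^ 2) := by
  rw [one_div, inv_re, normSq_apply, hu]
  simp [pow_two]

theorem log_mul_div_pi_le {n Q : ℕ} (hn : n ≤ Q) {g t : ℝ} (hn0 : 0 < n) (hg : 0 ≤ g)
    (ht : |t| ≤ 3 * g) :
    Real.log (n * (2.02 + |t|) / π) ≤ Real.log (Q * (1 + g)) := by
  have hπ := pi_gt_three
  have hπ' := pi_gt_d2
  have hn' : (n : ℝ) ≤ Q := by exact_mod_cast hn
  have hn0' : (0 : ℝ) < n := by exact_mod_cast hn0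
  apply Real.log_le_log (by positivity)
  rw [mul_div_assoc]
  refine mul_le_mul hn' ?_ (by positivity) (by positivity)
  rw [div_le_iff₀ pi_pos]
  nlinarith

theorem log_hundred_mul_gt {Q : ℕ} (hQ : 100 ≤ Q) {g : ℝ} (hg : 0 ≤ g) :
    4.5 < Real.log (Q * (1 + g)) := by
  have h : (100 : ℝ) ≤ Q := by exact_mod_cast hQ
  have h1 : (100 : ℝ) ≤ Q * (1 + g) := by nlinarith
  refine lt_of_lt_of_le ?_ (Real.log_le_log (by norm_num) h1)
  have h2 : (100 : ℝ) = 2 ^ 6 * (25 / 16) := by norm_num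
  rw [h2, Real.log_mul (by norm_num) (by norm_num), Real.log_pow]
  have h3 := Real.log_two_gt_d9
  have h4 := Real.one_sub_inv_le_log_of_pos (show (0 : ℝ) < 25 / 16 by norm_num)
  norm_num at h4 ⊢
  linarith

variable {n : ℕ} [NeZero n] {χ : DirichletCharacter ℂ n}

namespace DirichletCharacter

theorem sum_zeros_le_log (hχ : χ ≠ 1) (hp : χ.IsPrimitive) {Q : ℕ} (hn : n ≤ Q) {σ t g : ℝ}
    (hσ : 1 < σ) (hσ' : σ ≤ 1.04) (hg : 0 ≤ g) (ht : |t| ≤ 3 * g) {F : Finset ℂ}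
    (hF : ∀ ρ ∈ F, LFunction χ ρ = 0 ∧ 1 / 2 < ρ.re) :
    ∑ ρ ∈ F, (1 / ((σ : ℂ) + t * I - ρ)).re ≤ (logDeriv (LFunction χ) (σ + t * I)).re
      + Real.log (Q * (1 + g)) / 2 := by
  have h := sum_zeros_le_of_ne_one hχ hp (s := σ + t * I) (by simpa using hσ) (by simpa using hσ')
    hF
  have h' := log_mul_div_pi_le hn (NeZero.pos n) hg ht
  simp only [add_im, ofReal_im, mul_im, ofReal_re, I_im, I_re, mul_one, mul_zero, add_zero,
    zero_add] at h
  linarith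

end DirichletCharacter

theorem sum_zeros_riemannZeta_le_log {Q : ℕ} (hQ : 100 ≤ Q) {σ t g : ℝ}
    (hσ : 1 < σ) (hσ' : σ ≤ 1.04) (hg : 0 ≤ g) (ht : |t| ≤ 3 * g) {F : Finset ℂ}
    (hF : ∀ ρ ∈ F, riemannZeta ρ = 0 ∧ 1 / 2 < ρ.re) :
    ∑ ρ ∈ F, (1 / ((σ : ℂ) + t * I - ρ)).re ≤ (logDeriv riemannZeta (σ + t * I)).re
      + (σ - 1) / ((σ - 1) ^ 2 + t ^ 2) + Real.log (Q * (1 + g)) / 2 := by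
  have h := sum_zeros_riemannZeta_le (s := σ + t * I) (by simpa using hσ) (by simpa using hσ') hF
  have h' := log_mul_div_pi_le le_rfl one_pos hg ht
  have hL := log_hundred_mul_gt le_rfl le_rfl
  have hQ' : (100 : ℝ) ≤ Q := by exact_mod_cast hQ
  have e : Real.log (Q * (1 + g)) = Real.log Q + Real.log (1 + g) :=
    Real.log_mul (by positivity) (by positivity)
  have e' : Real.log 100 ≤ Real.log Q := Real.log_le_log (by norm_num) hQ'
  rw [re_one_div_sub_eq (ρ := 1) (u := t) (by simp), one_re] at h
  simp only [add_im, ofReal_im, mul_im, ofReal_re, I_im, I_re, mul_one, mul_zero, add_zero,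
    zero_add] at h
  simp only [Nat.cast_one, one_mul] at h'
  simp only [Nat.cast_ofNat, add_zero, mul_one] at hL
  linarith

theorem sum_zeros_riemannZeta_le_one_div {σ : ℝ} (hσ : 1 < σ) (hσ' : σ ≤ 1.04) {F : Finset ℂ}
    (hF : ∀ ρ ∈ F, riemannZeta ρ = 0 ∧ 1 / 2 < ρ.re) :
    ∑ ρ ∈ F, (1 / ((σ : ℂ) - ρ)).re ≤ (logDeriv riemannZeta σ).re + 1 / (σ - 1) + 1 := by
  have h := sum_zeros_riemannZeta_le (s := σ) (by simpa using hσ) (by simpa using hσ') hF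
  have h1 : (1 / ((σ : ℂ) - 1)).re = 1 / (σ - 1) := by
    rw [← ofReal_one, ← ofReal_sub, ← ofReal_div, ofReal_re]
  have h2 : Real.log ((2.02 + |(σ : ℂ).im|) / π) ≤ 0 := by
    have := pi_gt_three
    refine Real.log_nonpos (by positivity) ?_
    rw [ofReal_im, abs_zero, add_zero, div_le_one pi_pos]
    linarith
  rw [h1] at h
  linarith

theorem div_sq_add_sq_le {x y g : ℝ} (hy : 0 < y) (hyx : y ≤ x) (hx : x ≤ 5 / 4 * y) :
    4 * (y / (y ^ 2 + g ^ 2)) ≤ 5 * (x / (x ^ 2 + g ^ 2)) := by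
  have hx0 : 0 < x := hy.trans_le hyx
  rw [← mul_div_assoc, ← mul_div_assoc, div_le_div_iff₀ (by positivity) (by positivity)]
  have h1 : 0 ≤ (5 * x - 4 * y) * g ^ 2 := mul_nonneg (by linarith) (sq_nonneg g)
  have h2 : 0 ≤ x * y * (5 * y - 4 * x) := mul_nonneg (by positivity) (by linarith)
  nlinarith

namespace DirichletCharacter

theorem IsPrimitive.level_eq_one (hp : χ.IsPrimitive) (hχ : χ = 1) : n = 1 := by
  rw [isPrimitive_def, hχ, conductor_one] at hp
  exact hp.symm

omit [NeZero n] in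
theorem apply_sq_eq_one (hχ : χ ^ 2 = 1) {k : ℕ} (hk : k.Coprime n) : χ k ^ 2 = 1 := by
  rw [← MulChar.pow_apply' _ two_ne_zero, hχ,
    MulChar.one_apply ((ZMod.isUnit_iff_coprime k n).mpr hk)]

theorem re_lt_one_of_LFunction_eq_zero (hp : χ.IsPrimitive) {ρ : ℂ} (h0 : LFunction χ ρ = 0) :
    ρ.re < 1 := by
  by_contra! h
  by_cases hχ : χ = 1
  · obtain rfl := hp.level_eq_one hχ
    rw [LFunction_modOne_eq] at h0
    exact riemannZeta_ne_zero_of_one_le_re h h0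
  · exact LFunction_ne_zero_of_one_le_re χ (.inl hχ) h h0

theorem sq_eq_one_and_im_eq_zero (hp : χ.IsPrimitive) {Q : ℕ} (hQ : 100 ≤ Q) (hn : n ≤ Q)
    {ρ : ℂ} (h0 : LFunction χ ρ = 0)
    (hρ : 1 - ρ.re < 1 / (24 * Real.log (Q * (1 + |ρ.im|)))) :
    χ ^ 2 = 1 ∧ ρ.im = 0 := by
  by_contra hcon
  have hβ := re_lt_one_of_LFunction_eq_zero hp h0
  have hL := log_hundred_mul_gt hQ (abs_nonneg ρ.im)
  set L := Real.log (Q * (1 + |ρ.im|)) with hLdef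
  obtain ⟨y, hy⟩ : ∃ y, y = 1 / (6 * L) := ⟨_, rfl⟩
  have hy0 : 0 < y := by rw [hy]; positivity
  have hyL : 1 / y = 6 * L := by rw [hy, one_div_one_div]
  have hy1 : y ≤ 0.04 := by
    rw [hy, div_le_iff₀ (by positivity)]
    linarith
  have hρ' : 1 - ρ.re < y / 4 := by
    convert hρ using 1
    rw [hy]
    field_simp
    norm_num
  have hσ : 1 < 1 + y := by linarith
  have hσ' : 1 + y ≤ 1.04 := by linarith
  set σ := 1 + y with hσdef
  have hσy : σ - 1 = y := by rw [hσdef]; ring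
  set x := σ - ρ.re with hxdef
  have hyx : y ≤ x := by linarith
  have hxy : x ≤ 5 / 4 * y := by linarith
  have hx0 : 0 < x := by linarith
  have hβ' : 1 / 2 < ρ.re := by linarith
  have hA := fun u : ℝ => div_sq_add_sq_le (g := u) hy0 hyx hxy
  have hY (u : ℝ) : 0 ≤ y / (y ^ 2 + u ^ 2) := by positivity
  have hX0 : 4 * (1 / y) ≤ 5 * (x / (x ^ 2 + 0 ^ 2)) := by
    have h := hA 0
    have e : y / (y ^ 2 + 0 ^ 2) = 1 / y := by field_simp; ring
    rwa [e] at h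
  have hz0 := sum_zeros_riemannZeta_le_one_div hσ hσ' (F := ∅) (by simp)
  rw [Finset.sum_empty, hσy] at hz0
  have ht1 : |ρ.im| ≤ 3 * |ρ.im| := by linarith [abs_nonneg ρ.im]
  have ht2 : |2 * ρ.im| ≤ 3 * |ρ.im| := by
    rw [abs_mul, abs_two]; linarith [abs_nonneg ρ.im]
  have ht3 : |3 * ρ.im| ≤ 3 * |ρ.im| := by
    rw [abs_mul, abs_of_pos (by norm_num : (0 : ℝ) < 3)]
  have hz (t : ℝ) (ht : |t| ≤ 3 * |ρ.im|) :=
    sum_zeros_riemannZeta_le_log hQ hσ hσ' (abs_nonneg ρ.im) ht (F := ∅) (by simp)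
  simp only [Finset.sum_empty, hσy, ← hLdef] at hz
  have hXX (t u : ℝ) (ρ' : ℂ) (hre : ρ'.re = ρ.re) (hu : u ^ 2 = (t - ρ'.im) ^ 2) :
      (1 / ((σ : ℂ) + t * I - ρ')).re = x / (x ^ 2 + u ^ 2) := by
    rw [re_one_div_sub_eq hu, hre]
  have hXρ : (1 / ((σ : ℂ) + ρ.im * I - ρ)).re = x / (x ^ 2 + 0 ^ 2) := hXX _ _ _ rfl (by ring)
  have hXρ' : (1 / ((σ : ℂ) + ρ.im * I - conj ρ)).re = x / (x ^ 2 + (2 * ρ.im) ^ 2) :=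
    hXX _ _ _ (by simp) (by rw [conj_im]; ring)
  have hXρ'' : (1 / ((σ : ℂ) + (2 * ρ.im : ℝ) * I - conj ρ)).re
      = x / (x ^ 2 + (3 * ρ.im) ^ 2) := hXX _ _ _ (by simp) (by rw [conj_im]; ring)
  have hne : ρ.im ≠ 0 → ρ ≠ conj ρ := fun h h' => h (conj_eq_iff_im.mp h'.symm)
  by_cases hχ1 : χ = 1
  · obtain rfl := hp.level_eq_one hχ1
    have hγ : ρ.im ≠ 0 := fun h => hcon ⟨by rw [hχ1, one_pow], h⟩
    rw [LFunction_modOne_eq] at h0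
    have h0' : riemannZeta (conj ρ) = 0 := by rw [riemannZeta_conj, h0, map_zero]
    have hpair : ∀ z ∈ ({ρ, conj ρ} : Finset ℂ), riemannZeta z = 0 ∧ 1 / 2 < z.re := by
      simpa [h0, h0'] using hβ'
    have h5 := five_eight_four_one_inequality χ (1 : DirichletCharacter ℂ 1)
      (1 : DirichletCharacter ℂ 1)
      (fun k _ => by rw [hχ1, Subsingleton.elim (k : ZMod 1) 1, map_one, one_pow])
      (fun k _ => by rw [hχ1, Subsingleton.elim (k : ZMod 1) 1, map_one, one_pow]) hσ ρ.im
    simp only [LFunction_modOne_eq] at h5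
    have b0 := sum_zeros_riemannZeta_le_one_div hσ hσ' hpair
    have b1 := sum_zeros_riemannZeta_le_log hQ hσ hσ' (abs_nonneg ρ.im) ht1 hpair
    have b2 := sum_zeros_riemannZeta_le_log hQ hσ hσ' (abs_nonneg ρ.im) ht2 (F := {conj ρ})
      (by simpa [h0'] using hβ')
    have b3 := hz _ ht3
    have e1 := hXX 0 ρ.im ρ rfl (by ring)
    have e2 := hXX 0 ρ.im (conj ρ) (by simp) (by rw [conj_im]; ring)
    simp only [ofReal_zero, zero_mul, add_zero] at e1 e2
    rw [Finset.sum_pair (hne hγ), e1, e2, hσy] at b0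
    rw [Finset.sum_pair (hne hγ), hXρ, hXρ', hσy, ← hLdef] at b1
    rw [Finset.sum_singleton, hXρ'', hσy, ← hLdef] at b2
    linarith [hA ρ.im, hA (2 * ρ.im), hA (3 * ρ.im), hY ρ.im, hY (2 * ρ.im), hY (3 * ρ.im)]
  have hsum (F : Finset ℂ) {t : ℝ} (ht : |t| ≤ 3 * |ρ.im|)
      (hF : ∀ z ∈ F, LFunction χ z = 0 ∧ 1 / 2 < z.re) :=
    sum_zeros_le_log hχ1 hp hn hσ hσ' (abs_nonneg ρ.im) ht hF
  simp only [← hLdef] at hsum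
  by_cases hχ2 : χ ^ 2 = 1
  · have hγ : ρ.im ≠ 0 := fun h => hcon ⟨hχ2, h⟩
    have hinv : χ⁻¹ = χ := inv_eq_of_mul_eq_one_left (by rw [← pow_two, hχ2])
    have h0' : LFunction χ (conj ρ) = 0 := by
      have := LFunction_inv_conj hχ1 ρ
      rwa [hinv, h0, map_zero] at this
    have h5 := five_eight_four_one_inequality χ (1 : DirichletCharacter ℂ 1) χ
      (fun k hk => by
        rw [apply_sq_eq_one hχ2 hk, Subsingleton.elim (k : ZMod 1) 1, map_one])
      (fun k hk => by rw [pow_succ, apply_sq_eq_one hχ2 hk, one_mul]) hσ ρ.im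
    rw [LFunction_modOne_eq] at h5
    have b1 := hsum {ρ, conj ρ} ht1 (by simpa [h0, h0'] using hβ')
    have b2 := hz _ ht2
    have b3 := hsum ∅ ht3 (by simp)
    rw [Finset.sum_pair (hne hγ), hXρ, hXρ'] at b1
    rw [Finset.sum_empty] at b3
    linarith [hA (2 * ρ.im), hY (2 * ρ.im)]
  have b1 := hsum {ρ} ht1 (by simpa [h0] using hβ')
  rw [Finset.sum_singleton, hXρ] at b1
  by_cases hχ3 : χ ^ 3 = 1
  · have hinv : χ⁻¹ = χ ^ 2 := inv_eq_of_mul_eq_one_left (by rw [← pow_succ, hχ3])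
    have h5 := five_eight_four_one_inequality χ χ⁻¹ (1 : DirichletCharacter ℂ 1)
      (fun k _ => by rw [hinv, MulChar.pow_apply' _ two_ne_zero])
      (fun k hk => by
        rw [← MulChar.pow_apply' _ three_ne_zero, hχ3,
          MulChar.one_apply ((ZMod.isUnit_iff_coprime k n).mpr hk),
          Subsingleton.elim (k : ZMod 1) 1, map_one]) hσ ρ.im
    rw [LFunction_modOne_eq] at h5
    have h0' : LFunction χ⁻¹ (conj ρ) = 0 := by rw [LFunction_inv_conj hχ1, h0, map_zero]
    have hp' : χ⁻¹.IsPrimitive := by rw [isPrimitive_def, conductor_inv, hp]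
    have b2 := sum_zeros_le_log (by simpa using hχ1) hp' hn hσ hσ' (abs_nonneg ρ.im) ht2
      (F := {conj ρ}) (by simpa [h0'] using hβ')
    have b3 := hz _ ht3
    rw [Finset.sum_singleton, hXρ'', ← hLdef] at b2
    linarith [hA (3 * ρ.im), hY (3 * ρ.im)]
  have hprim (k : ℕ) (hk : χ ^ k ≠ 1) (ht : |k * ρ.im| ≤ 3 * |ρ.im|) :
      haveI : NeZero (χ ^ k).conductor := ⟨conductor_ne_zero _⟩
      0 ≤ (logDeriv (LFunction (χ ^ k).primitiveCharacter) (σ + (k * ρ.im : ℝ) * I)).re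
        + L / 2 := by
    have : NeZero (χ ^ k).conductor := ⟨conductor_ne_zero _⟩
    simpa using sum_zeros_le_log (F := ∅) (fun h => hk (by
        rw [← changeLevel_primitiveCharacter (χ ^ k), h, changeLevel_one]))
      (primitiveCharacter_isPrimitive _)
      ((Nat.le_of_dvd (NeZero.pos n) (conductor_dvd_level _)).trans hn) hσ hσ'
      (abs_nonneg ρ.im) ht (by simp)
  have hcop (k : ℕ) (hk : k ≠ 0) (m : ℕ) (hm : m.Coprime n) :
      (χ ^ k).primitiveCharacter m = χ m ^ k := by
    have := primitiveCharacter_apply_of_isCoprime (χ := χ ^ k) (Nat.isCoprime_iff_coprime.mpr hm)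
    rw [← MulChar.pow_apply' _ hk]
    exact_mod_cast this
  have : NeZero (χ ^ 2).conductor := ⟨conductor_ne_zero _⟩
  have : NeZero (χ ^ 3).conductor := ⟨conductor_ne_zero _⟩
  have h5 := five_eight_four_one_inequality χ (χ ^ 2).primitiveCharacter
    (χ ^ 3).primitiveCharacter (hcop 2 two_ne_zero) (hcop 3 three_ne_zero) hσ ρ.im
  have b2 := hprim 2 hχ2 (by exact_mod_cast ht2)
  have b3 := hprim 3 hχ3 (by exact_mod_cast ht3)
  rw [Nat.cast_ofNat] at b2 b3
  linarith

end DirichletCharacter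

end ZeroFreeRegion

section Landau

open Complex DirichletCharacter
open scoped ArithmeticFunction

namespace DirichletCharacter

variable {n₁ n₂ : ℕ} [NeZero n₁] [NeZero n₂] {χ₁ : DirichletCharacter ℂ n₁}
  {χ₂ : DirichletCharacter ℂ n₂}

omit [NeZero n₁] [NeZero n₂] in
theorem mul_apply_natCast_of_coprime {k : ℕ} (h₁ : k.Coprime n₁) (h₂ : k.Coprime n₂) :
    mul χ₁ χ₂ k = χ₁ k * χ₂ k := by
  have h : IsCoprime (k : ℤ) (n₁.lcm n₂ : ℕ) :=
    Nat.isCoprime_iff_coprime.mpr ((h₁.mul_right h₂).coprime_dvd_right (Nat.lcm_dvd_mul _ _))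
  have e₁ := changeLevel_eq_cast_of_dvd' χ₁ (Nat.dvd_lcm_left n₁ n₂) h
  have e₂ := changeLevel_eq_cast_of_dvd' χ₂ (Nat.dvd_lcm_right n₁ n₂) h
  rw [Int.cast_natCast, Int.cast_natCast] at e₁ e₂
  rw [mul, MulChar.mul_apply, e₁, e₂]

omit [NeZero n₁] [NeZero n₂] in
theorem primitive_mul_apply_natCast_of_coprime {k : ℕ} (h₁ : k.Coprime n₁) (h₂ : k.Coprime n₂) :
    primitive_mul χ₁ χ₂ k = χ₁ k * χ₂ k := by
  have h : IsCoprime (k : ℤ) (n₁.lcm n₂ : ℕ) :=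
    Nat.isCoprime_iff_coprime.mpr ((h₁.mul_right h₂).coprime_dvd_right (Nat.lcm_dvd_mul _ _))
  have := primitiveCharacter_apply_of_isCoprime (χ := mul χ₁ χ₂) h
  rw [Int.cast_natCast, Int.cast_natCast] at this
  rw [primitive_mul, this, mul_apply_natCast_of_coprime h₁ h₂]

theorem changeLevel_sq_eq_one {n m : ℕ} {χ : DirichletCharacter ℂ n} (h : n ∣ m)
    (hχ : χ ^ 2 = 1) : changeLevel h χ ^ 2 = 1 := by
  rw [← map_pow, hχ, map_one]

instance neZero_conductor {n : ℕ} [NeZero n] (χ : DirichletCharacter ℂ n) :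
    NeZero χ.conductor := ⟨conductor_ne_zero χ⟩

instance neZero_lcm : NeZero (n₁.lcm n₂) :=
  ⟨Nat.lcm_ne_zero (NeZero.ne n₁) (NeZero.ne n₂)⟩

theorem sigma_eq_of_mul_eq_one (hp₁ : χ₁.IsPrimitive) (hp₂ : χ₂.IsPrimitive) (h₂ : χ₂ ^ 2 = 1)
    (h : mul χ₁ χ₂ = 1) :
    (⟨n₁, χ₁⟩ : Σ n : ℕ, DirichletCharacter ℂ n) = ⟨n₂, χ₂⟩ := by
  have e : changeLevel (Nat.dvd_lcm_left n₁ n₂) χ₁ = changeLevel (Nat.dvd_lcm_right n₁ n₂) χ₂ := by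
    rw [mul] at h
    rw [eq_inv_of_mul_eq_one_left h]
    exact inv_eq_of_mul_eq_one_left (by rw [← pow_two, changeLevel_sq_eq_one _ h₂])
  have hn : n₁ = n₂ := by
    rw [← hp₁, ← hp₂, ← conductor_changeLevel χ₁ (Nat.dvd_lcm_left n₁ n₂), e,
      conductor_changeLevel]
  subst hn
  rw [changeLevel_injective _ e]

theorem dvd_lcm_conductor_mul (hp₁ : χ₁.IsPrimitive) (hp₂ : χ₂.IsPrimitive) (h₂ : χ₂ ^ 2 = 1) :
    n₁ ∣ (mul χ₁ χ₂).conductor.lcm n₂ := by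
  have h := conductor_mul_dvd_lcm_conductor (mul χ₁ χ₂)
    (changeLevel (Nat.dvd_lcm_right n₁ n₂) χ₂)
  rwa [mul, mul_assoc, ← pow_two, changeLevel_sq_eq_one _ h₂, mul_one, ← mul,
    conductor_changeLevel, conductor_changeLevel, hp₁, hp₂] at h

theorem dvd_lcm_conductor_mul' (hp₁ : χ₁.IsPrimitive) (hp₂ : χ₂.IsPrimitive) (h₁ : χ₁ ^ 2 = 1) :
    n₂ ∣ (mul χ₁ χ₂).conductor.lcm n₁ := by
  have h := conductor_mul_dvd_lcm_conductor (mul χ₁ χ₂)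
    (changeLevel (Nat.dvd_lcm_left n₁ n₂) χ₁)
  rwa [mul, mul_right_comm, ← pow_two, changeLevel_sq_eq_one _ h₁, one_mul, ← mul,
    conductor_changeLevel, conductor_changeLevel, hp₁, hp₂] at h

theorem apply_natCast_eq_zero {n k : ℕ} (χ : DirichletCharacter ℂ n) (h : ¬ k.Coprime n) :
    χ k = 0 :=
  χ.map_nonunit fun hu => h ((ZMod.isUnit_iff_coprime k n).mp hu)

theorem neg_one_le_re_apply {n : ℕ} (χ : DirichletCharacter ℂ n) (k : ZMod n) :
    -1 ≤ (χ k).re :=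
  (abs_le.mp ((abs_re_le_norm _).trans (χ.norm_le_one k))).1

omit [NeZero n₁] in
theorem im_apply_eq_zero (h : χ₁ ^ 2 = 1) (a : ZMod n₁) : (χ₁ a).im = 0 := by
  by_cases ha : IsUnit a
  · have : χ₁ a ^ 2 = 1 := by
      rw [← MulChar.pow_apply' _ two_ne_zero, h, MulChar.one_apply ha]
    rcases eq_or_eq_neg_of_sq_eq_sq _ _ (this.trans (one_pow 2).symm) with h | h <;> simp [h]
  · simp [χ₁.map_nonunit ha]

theorem one_add_re_add_re_add_re_nonneg (hp₁ : χ₁.IsPrimitive) (hp₂ : χ₂.IsPrimitive)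
    (h₁ : χ₁ ^ 2 = 1) (h₂ : χ₂ ^ 2 = 1) {k : ℕ} (hk : IsPrimePow k) :
    0 ≤ 1 + (χ₁ k).re + (χ₂ k).re + (primitive_mul χ₁ χ₂ k).re := by
  obtain ⟨p, j, hp, hj, rfl⟩ := hk
  have hp' := hp.nat_prime
  have hcop (m : ℕ) : (p ^ j).Coprime m ↔ ¬ p ∣ m := by
    rw [Nat.coprime_pow_left_iff hj, hp'.coprime_iff_not_dvd]
  have b₁ := neg_one_le_re_apply χ₁ (p ^ j : ℕ)
  have b₂ := neg_one_le_re_apply χ₂ (p ^ j : ℕ)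
  have b₃ := neg_one_le_re_apply (primitive_mul χ₁ χ₂) (p ^ j : ℕ)
  by_cases c₁ : p ∣ n₁ <;> by_cases c₂ : p ∣ n₂
  · rw [apply_natCast_eq_zero χ₁ (by simpa [hcop] using c₁),
      apply_natCast_eq_zero χ₂ (by simpa [hcop] using c₂)]
    simp only [zero_re]
    linarith
  · have hm : p ∣ (mul χ₁ χ₂).conductor :=
      ((hp'.dvd_lcm).mp (c₁.trans (dvd_lcm_conductor_mul hp₁ hp₂ h₂))).resolve_right c₂
    rw [apply_natCast_eq_zero χ₁ (by simpa [hcop] using c₁),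
      apply_natCast_eq_zero (primitive_mul χ₁ χ₂) (by simpa [hcop] using hm)]
    simp only [zero_re]
    linarith
  · have hm : p ∣ (mul χ₁ χ₂).conductor :=
      ((hp'.dvd_lcm).mp (c₂.trans (dvd_lcm_conductor_mul' hp₁ hp₂ h₁))).resolve_right c₁
    rw [apply_natCast_eq_zero χ₂ (by simpa [hcop] using c₂),
      apply_natCast_eq_zero (primitive_mul χ₁ χ₂) (by simpa [hcop] using hm)]
    simp only [zero_re]
    linarith
  · rw [primitive_mul_apply_natCast_of_coprime ((hcop _).mpr c₁) ((hcop _).mpr c₂), mul_re,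
      im_apply_eq_zero h₁, zero_mul, sub_zero]
    nlinarith

theorem exists_real_zero (hp₁ : χ₁.IsPrimitive) {Q : ℕ} (hQ : 100 ≤ Q) (hn : n₁ ≤ Q)
    (h : ∃ s : ℂ, LFunction χ₁ s = 0 ∧
      1 - s.re < 1 / (24 * Real.log ((Q : ℝ) * (1 + |s.im|)))) :
    χ₁ ^ 2 = 1 ∧ ∃ β : ℝ, LFunction χ₁ β = 0 ∧ β < 1 ∧ 1 - β < 1 / (24 * Real.log Q) := by
  obtain ⟨s, hs, hs'⟩ := h
  obtain ⟨h1, h2⟩ := sq_eq_one_and_im_eq_zero hp₁ hQ hn hs hs'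
  have e : (s.re : ℂ) = s := Complex.ext rfl h2.symm
  refine ⟨h1, s.re, by rw [e, hs], re_lt_one_of_LFunction_eq_zero hp₁ hs, ?_⟩
  simpa [h2] using hs'

theorem exists_test_point {Q : ℕ} (hQ : 100 ≤ Q) :
    ∃ σ : ℝ, 1 < σ ∧ σ ≤ 1.04 ∧ 1 / (σ - 1) = 6 * Real.log Q ∧ ∀ β : ℝ, β < 1 →
      1 - β < 1 / (24 * Real.log Q) → 1 / 2 < β ∧
        24 / 5 * Real.log Q ≤ (1 / ((σ : ℂ) - β)).re := by
  have hL := log_hundred_mul_gt hQ le_rfl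
  rw [add_zero, mul_one] at hL
  generalize Real.log Q = L at hL ⊢
  have hL0 : 0 < L := by linarith
  have hy : 1 / (6 * L) ≤ 0.04 := by
    rw [div_le_iff₀ (by positivity)]
    linarith
  have hy0 : 0 < 1 / (6 * L) := by positivity
  have hy4 : 1 / (24 * L) = 1 / (6 * L) / 4 := by
    field_simp
    norm_num
  refine ⟨1 + 1 / (6 * L), by linarith, by linarith, by rw [add_sub_cancel_left, one_div_one_div],
    fun β hβ hb => ⟨by linarith, ?_⟩⟩
  rw [← ofReal_sub, ← ofReal_one, ← ofReal_div, ofReal_re, le_div_iff₀ (by linarith)]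
  calc 24 / 5 * L * (1 + 1 / (6 * L) - β) ≤ 24 / 5 * L * (5 / 4 * (1 / (6 * L))) := by
        gcongr
        linarith
    _ = 1 := by
        field_simp
        norm_num

theorem not_real_zeros_riemannZeta_LFunction (hp₂ : χ₂.IsPrimitive) (hχ₂ : χ₂ ≠ 1) {Q : ℕ}
    (hQ : 100 ≤ Q) (hn₂ : n₂ ≤ Q) {β₁ β₂ : ℝ} (h₁ : riemannZeta β₁ = 0)
    (h₂ : LFunction χ₂ β₂ = 0) (hβ₁ : β₁ < 1) (hβ₂ : β₂ < 1)
    (hb₁ : 1 - β₁ < 1 / (24 * Real.log Q)) (hb₂ : 1 - β₂ < 1 / (24 * Real.log Q)) : False := by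
  have hL := log_hundred_mul_gt hQ le_rfl
  obtain ⟨σ, hσ, hσ', hy, hx⟩ := exists_test_point hQ
  have b₁ := sum_zeros_riemannZeta_le_one_div hσ hσ' (F := {(β₁ : ℂ)})
    (by simpa [h₁] using (hx β₁ hβ₁ hb₁).1)
  have b₂ := sum_zeros_le_log hχ₂ hp₂ hn₂ hσ hσ' le_rfl (t := 0) (by simp) (F := {(β₂ : ℂ)})
    (by simpa [h₂] using (hx β₂ hβ₂ hb₂).1)
  have h := one_one_inequality χ₂ hσ
  simp only [Finset.sum_singleton, ofReal_zero, zero_mul, add_zero, mul_one] at b₁ b₂ hL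
  linarith [(hx β₁ hβ₁ hb₁).2, (hx β₂ hβ₂ hb₂).2]

theorem primitive_mul_ne_one (hp₁ : χ₁.IsPrimitive) (hp₂ : χ₂.IsPrimitive) (h₂ : χ₂ ^ 2 = 1)
    (hne : (⟨n₁, χ₁⟩ : Σ n : ℕ, DirichletCharacter ℂ n) ≠ ⟨n₂, χ₂⟩) :
    primitive_mul χ₁ χ₂ ≠ 1 := fun h =>
  hne <| sigma_eq_of_mul_eq_one hp₁ hp₂ h₂ <| by
    rw [← changeLevel_primitiveCharacter (mul χ₁ χ₂), ← mul_def, h, changeLevel_one]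

theorem neg_log_le_re_logDeriv_primitive_mul (h : primitive_mul χ₁ χ₂ ≠ 1) {Q : ℕ}
    (hn₁ : n₁ ≤ Q) (hn₂ : n₂ ≤ Q) {σ : ℝ} (hσ : 1 < σ) (hσ' : σ ≤ 1.04) :
    -Real.log Q ≤ (logDeriv (LFunction (primitive_mul χ₁ χ₂)) σ).re := by
  have b := sum_zeros_le_of_ne_one h (primitive_mul_isPrimitive _ _) (s := σ) (by simpa using hσ)
    (by simpa using hσ') (F := ∅) (by simp)
  have hm : (mul χ₁ χ₂).conductor ≤ Q * Q :=
    (Nat.le_of_dvd (NeZero.pos _) (conductor_dvd_level _)).trans <|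
      (Nat.le_of_dvd (Nat.mul_pos (NeZero.pos n₁) (NeZero.pos n₂)) (Nat.lcm_dvd_mul _ _)).trans
        (Nat.mul_le_mul hn₁ hn₂)
  have hl := log_mul_div_pi_le hm (g := 0) (t := 0) (NeZero.pos _) le_rfl (by simp)
  have hQ : (Q : ℝ) ≠ 0 := by exact_mod_cast ((NeZero.pos n₁).trans_le hn₁).ne'
  rw [add_zero, mul_one, Nat.cast_mul, Real.log_mul hQ hQ] at hl
  rw [Finset.sum_empty, ofReal_im] at b
  linarith

theorem sigma_eq_of_real_zeros (hp₁ : χ₁.IsPrimitive) (hp₂ : χ₂.IsPrimitive) (hχ₁ : χ₁ ^ 2 = 1)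
    (hχ₂ : χ₂ ^ 2 = 1) {Q : ℕ} (hQ : 100 ≤ Q) (hn₁ : n₁ ≤ Q) (hn₂ : n₂ ≤ Q) {β₁ β₂ : ℝ}
    (h₁ : LFunction χ₁ β₁ = 0) (h₂ : LFunction χ₂ β₂ = 0) (hβ₁ : β₁ < 1) (hβ₂ : β₂ < 1)
    (hb₁ : 1 - β₁ < 1 / (24 * Real.log Q)) (hb₂ : 1 - β₂ < 1 / (24 * Real.log Q)) :
    (⟨n₁, χ₁⟩ : Σ n : ℕ, DirichletCharacter ℂ n) = ⟨n₂, χ₂⟩ := by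
  by_contra hne
  by_cases t₁ : χ₁ = 1
  · obtain rfl := hp₁.level_eq_one t₁
    by_cases t₂ : χ₂ = 1
    · obtain rfl := hp₂.level_eq_one t₂
      exact hne (by rw [t₁, t₂])
    · rw [LFunction_modOne_eq] at h₁
      exact not_real_zeros_riemannZeta_LFunction hp₂ t₂ hQ hn₂ h₁ h₂ hβ₁ hβ₂ hb₁ hb₂
  by_cases t₂ : χ₂ = 1
  · obtain rfl := hp₂.level_eq_one t₂
    rw [LFunction_modOne_eq] at h₂
    exact not_real_zeros_riemannZeta_LFunction hp₁ t₁ hQ hn₁ h₂ h₁ hβ₂ hβ₁ hb₂ hb₁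
  have hL := log_hundred_mul_gt hQ le_rfl
  obtain ⟨σ, hσ, hσ', hy, hx⟩ := exists_test_point hQ
  have b₀ := sum_zeros_riemannZeta_le_one_div hσ hσ' (F := ∅) (by simp)
  have b₁ := sum_zeros_le_log t₁ hp₁ hn₁ hσ hσ' le_rfl (t := 0) (by simp) (F := {(β₁ : ℂ)})
    (by simpa [h₁] using (hx β₁ hβ₁ hb₁).1)
  have b₂ := sum_zeros_le_log t₂ hp₂ hn₂ hσ hσ' le_rfl (t := 0) (by simp) (F := {(β₂ : ℂ)})
    (by simpa [h₂] using (hx β₂ hβ₂ hb₂).1)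
  have b₃ := neg_log_le_re_logDeriv_primitive_mul (primitive_mul_ne_one hp₁ hp₂ hχ₂ hne)
    hn₁ hn₂ hσ hσ'
  have h := one_one_one_one_inequality χ₁ χ₂ (primitive_mul χ₁ χ₂) (fun k hk =>
    one_add_re_add_re_add_re_nonneg hp₁ hp₂ hχ₁ hχ₂
      (ArithmeticFunction.vonMangoldt_ne_zero_iff.mp hk)) hσ
  simp only [Finset.sum_empty, Finset.sum_singleton, ofReal_zero, zero_mul, add_zero, mul_one]
    at b₀ b₁ b₂ hL
  linarith [(hx β₁ hβ₁ hb₁).2, (hx β₂ hβ₂ hb₂).2]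

end DirichletCharacter

end Landau

/-- For `Q ≥ 100` there is at most one primitive Dirichlet character of conductor at most `Q`
whose `L`-function has a zero in the region `1 − σ < 1/(24·log(Q(1+|t|)))`; if it exists,
it is a real character and all its zeros in that region are real. -/
theorem at_most_one_exceptional_character (Q : ℕ) (hQ : 100 ≤ Q) :
    (∀ p₁ p₂ : Σ n : ℕ, DirichletCharacter ℂ n,
      HasExceptionalZero Q p₁ → HasExceptionalZero Q p₂ → p₁ = p₂) ∧
    (∀ (n : ℕ) (h : NeZero n) (χ : DirichletCharacter ℂ n),
      HasExceptionalZero Q ⟨n, χ⟩ →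
        (∀ a : ZMod n, (χ a).im = 0) ∧
        (∀ s : ℂ, @DirichletCharacter.LFunction n h χ s = 0 →
          1 - s.re < 1 / (24 * Real.log ((Q : ℝ) * (1 + |s.im|))) → s.im = 0)) := by
  constructor
  · rintro ⟨n₁, χ₁⟩ ⟨n₂, χ₂⟩ ⟨i₁, hn₁, hp₁, hs₁⟩ ⟨i₂, hn₂, hp₂, hs₂⟩
    obtain ⟨q₁, β₁, h₁, hβ₁, hb₁⟩ := DirichletCharacter.exists_real_zero hp₁ hQ hn₁ hs₁
    obtain ⟨q₂, β₂, h₂, hβ₂, hb₂⟩ := DirichletCharacter.exists_real_zero hp₂ hQ hn₂ hs₂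
    exact DirichletCharacter.sigma_eq_of_real_zeros hp₁ hp₂ q₁ q₂ hQ hn₁ hn₂ h₁ h₂ hβ₁ hβ₂ hb₁ hb₂
  · rintro n h χ ⟨_, hn, hp, s, hs, hs'⟩
    exact ⟨DirichletCharacter.im_apply_eq_zero
        (DirichletCharacter.sq_eq_one_and_im_eq_zero hp hQ hn hs hs').1,
      fun z hz hz' => (DirichletCharacter.sq_eq_one_and_im_eq_zero hp hQ hn hz hz').2⟩
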